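/- (Schneider's theorem) Let n ≥ 2 and let B ⊂ ℝ^{n+1} be a convex body containing the origin in its interior. If all hyperplane sections of B through the origin are congruent to one another (for any two n-dimensional linear subspaces H₁, H₂ of ℝ^{n+1} there is an isometry f of ℝ^{n+1} with f(B ∩ H₁) = B ∩ H₂), then B is a closed Euclidean ball centered at the origin. -/

import Mathlib

open Metric

section CongruentSections

open MeasureTheory ProbabilityTheory Filter Topology Asymptotics
open scoped RealInnerProductSpace NNReal

section FunkUniqueness

variable {H : Type*} [NormedAddCommGroup H] [InnerProductSpace ℝ H] [FiniteDimensional ℝ H]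
  [MeasurableSpace H] [BorelSpace H]

lemma stdGaussian_map_inner (y : H) :
    (stdGaussian H).map (fun a => ⟪a, y⟫) = (gaussianReal 0 1).map (fun t => ‖y‖ * t) := by
  have h := IsGaussian.map_eq_gaussianReal (μ := stdGaussian H) (innerSL ℝ y)
  rw [integral_strongDual_stdGaussian, variance_dual_stdGaussian] at h
  rw [gaussianReal_map_const_mul]
  have h2 : (fun a : H => ⟪a, y⟫) = ⇑(innerSL ℝ y) := by
    ext a; simp [real_inner_comm]
  rw [h2, h]
  congr 1
  · simp
  · ext
    simp

lemma integrable_of_bounded_support {Φ : H × ℝ → ℝ} (hm : Measurable Φ) {C R : ℝ}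
    (hC : ∀ x, |Φ x| ≤ C) (hR : ∀ y t, R < ‖y‖ → Φ (y, t) = 0) {Ω : Type*} [MeasurableSpace Ω]
    (μ : Measure Ω) [IsProbabilityMeasure μ] {T : H × Ω → ℝ} (hT : Measurable T) :
    Integrable (fun p : H × Ω => Φ (p.1, T p)) ((volume : Measure H).prod μ) := by
  have hb : Integrable (fun p : H × Ω => (closedBall (0 : H) R).indicator (fun _ => C) p.1 * 1)
      ((volume : Measure H).prod μ) := by
    refine Integrable.mul_prod (f := (closedBall (0 : H) R).indicator (fun _ => C))
      (g := fun _ : Ω => (1 : ℝ)) ?_ (integrable_const _)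
    rw [integrable_indicator_iff measurableSet_closedBall]
    exact integrableOn_const (measure_closedBall_lt_top.ne)
  refine hb.mono' (hm.comp (measurable_fst.prodMk hT)).aestronglyMeasurable (ae_of_all _ ?_)
  rintro ⟨y, ω⟩
  by_cases hy : ‖y‖ ≤ R
  · have : y ∈ closedBall (0 : H) R := by simpa using hy
    simp [Set.indicator_of_mem this, hC]
  · have : y ∉ closedBall (0 : H) R := by simpa using hy
    simp [Set.indicator_of_notMem this, hR y _ (not_le.1 hy)]

lemma integral_gaussian_cone_eq_zero {Φ : H × ℝ → ℝ} (hm : Measurable Φ) {C R : ℝ}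
    (hC : ∀ x, |Φ x| ≤ C) (hR : ∀ y t, R < ‖y‖ → Φ (y, t) = 0)
    (h0 : ∀ a : H, ∫ y, Φ (y, ⟪a, y⟫) = 0) (σ : ℝ) :
    ∫ t, (∫ y, Φ (y, σ * t * ‖y‖)) ∂(gaussianReal 0 1) = 0 := by
  have h1 : ∫ a, (∫ y, Φ (y, σ * ⟪a, y⟫)) ∂(stdGaussian H) = 0 := by
    have : ∀ a : H, (∫ y, Φ (y, σ * ⟪a, y⟫)) = 0 := fun a => by
      have := h0 (σ • a)
      simpa [inner_smul_left] using this
    simp [this]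
  rw [← integral_integral_swap] at h1
  swap
  · exact integrable_of_bounded_support hm hC hR (stdGaussian H)
      (T := fun p => σ * ⟪p.2, p.1⟫) (by fun_prop)
  rw [← integral_integral_swap]
  swap
  · exact integrable_of_bounded_support hm hC hR (gaussianReal 0 1)
      (T := fun p => σ * p.2 * ‖p.1‖) (by fun_prop)
  refine Eq.trans ?_ h1
  refine integral_congr_ae (ae_of_all _ fun y => ?_)
  have hmeas : AEStronglyMeasurable (fun s : ℝ => Φ (y, σ * s))
      ((stdGaussian H).map (fun a => ⟪a, y⟫)) := by
    apply Measurable.aestronglyMeasurable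
    fun_prop
  have e1 := integral_map (μ := stdGaussian H) (φ := fun a => ⟪a, y⟫)
    (f := fun s => Φ (y, σ * s)) (by fun_prop) hmeas
  rw [stdGaussian_map_inner] at e1 hmeas
  rw [integral_map (by fun_prop) hmeas] at e1
  have e2 : ∀ t, σ * (‖y‖ * t) = σ * t * ‖y‖ := fun t => by ring
  simp only [e2] at e1
  exact e1

lemma integral_exp_neg_sq_cone_eq_zero {Φ : H × ℝ → ℝ} (hm : Measurable Φ) {C R : ℝ}
    (hC : ∀ x, |Φ x| ≤ C) (hR : ∀ y t, R < ‖y‖ → Φ (y, t) = 0)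
    (h0 : ∀ a : H, ∫ y, Φ (y, ⟪a, y⟫) = 0) {s : ℝ} (hs : 0 < s) :
    ∫ t, Real.exp (-s * t ^ 2) * (∫ y, Φ (y, t * ‖y‖)) = 0 := by
  have hσ : 0 < √(1 / (2 * s)) := by positivity
  have h := integral_gaussian_cone_eq_zero hm hC hR h0 √(1 / (2 * s))
  rw [integral_gaussianReal_eq_integral_smul one_ne_zero] at h
  have hsub := Measure.integral_comp_smul (volume : Measure ℝ)
    (fun t => Real.exp (-s * t ^ 2) * (∫ y, Φ (y, t * ‖y‖))) √(1 / (2 * s))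
  have e : (fun t => gaussianPDFReal 0 1 t • ∫ y, Φ (y, √(1 / (2 * s)) * t * ‖y‖)) =
      fun t => (√(2 * Real.pi))⁻¹ * ((fun t => Real.exp (-s * t ^ 2) *
        (∫ y, Φ (y, t * ‖y‖))) (√(1 / (2 * s)) • t)) := by
    ext t
    simp only [gaussianPDFReal_def, smul_eq_mul, mul_pow]
    rw [Real.sq_sqrt (by positivity), mul_assoc]
    congr 2
    · simp
    · congr 1
      simp
      field_simp
  rw [e, integral_const_mul, hsub] at h
  have hp : (√(2 * Real.pi))⁻¹ ≠ 0 := by positivity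
  have hq : |(√(1 / (2 * s)) ^ Module.finrank ℝ ℝ)⁻¹| ≠ 0 := by simp; positivity
  rw [smul_eq_mul] at h
  exact ((mul_eq_zero.1 ((mul_eq_zero.1 h).resolve_left hp)).resolve_left hq)

end FunkUniqueness

section LaplaceUniqueness

variable {A : ℝ → ℝ} {M : ℝ}

lemma integrable_exp_neg_sq_mul (hA : AEStronglyMeasurable A) (hM : ∀ t, |A t| ≤ M) {s : ℝ}
    (hs : 0 < s) : Integrable fun t => Real.exp (-s * t ^ 2) * A t :=
  (integrable_exp_neg_mul_sq hs).mul_bdd hA (ae_of_all _ hM)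

lemma integral_exp_neg_sq_mul_polynomial_eq_zero (hA : AEStronglyMeasurable A)
    (hM : ∀ t, |A t| ≤ M)
    (h0 : ∀ s : ℝ, 0 < s → ∫ t, Real.exp (-s * t ^ 2) * A t = 0) (p : Polynomial ℝ) :
    ∫ t, Real.exp (-1 * t ^ 2) * A t * p.eval (Real.exp (-1 * t ^ 2)) = 0 := by
  have e : (fun t => Real.exp (-1 * t ^ 2) * A t * p.eval (Real.exp (-1 * t ^ 2))) =
      fun t => ∑ i ∈ Finset.range (p.natDegree + 1),
        p.coeff i * (Real.exp (-((i : ℝ) + 1) * t ^ 2) * A t) := by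
    ext t
    rw [Polynomial.eval_eq_sum_range, Finset.mul_sum]
    refine Finset.sum_congr rfl fun i _ => ?_
    rw [← Real.exp_nat_mul, show -((i : ℝ) + 1) * t ^ 2 = (-1 * t ^ 2) + i * (-1 * t ^ 2) by ring,
      Real.exp_add]
    ring
  rw [e, integral_finsetSum]
  · refine Finset.sum_eq_zero fun i _ => ?_
    rw [integral_const_mul, h0 _ (by positivity), mul_zero]
  · intro i _
    exact (integrable_exp_neg_sq_mul hA hM (by positivity)).const_mul _

lemma integral_exp_neg_sq_mul_continuous_eq_zero (hA : AEStronglyMeasurable A)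
    (hM : ∀ t, |A t| ≤ M)
    (h0 : ∀ s : ℝ, 0 < s → ∫ t, Real.exp (-s * t ^ 2) * A t = 0) {h : ℝ → ℝ}
    (hh : Continuous h) :
    ∫ t, Real.exp (-1 * t ^ 2) * A t * h (Real.exp (-1 * t ^ 2)) = 0 := by
  have hInt := integrable_exp_neg_sq_mul hA hM one_pos
  have hmem : ∀ t : ℝ, Real.exp (-1 * t ^ 2) ∈ Set.Icc (0 : ℝ) 1 := fun t =>
    ⟨(Real.exp_pos _).le, Real.exp_le_one_iff.2 (by nlinarith [sq_nonneg t])⟩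
  have hbd : ∀ f : ℝ → ℝ, Continuous f →
      Integrable fun t => Real.exp (-1 * t ^ 2) * A t * f (Real.exp (-1 * t ^ 2)) := by
    intro f hf
    obtain ⟨K, hK⟩ := isCompact_Icc.exists_bound_of_continuousOn
      (hf.continuousOn (s := Set.Icc (0 : ℝ) 1))
    exact hInt.mul_bdd (c := K) (by fun_prop) (ae_of_all _ fun t => hK _ (hmem t))
  set I := ∫ t, |Real.exp (-1 * t ^ 2) * A t| with hI
  have hI0 : 0 ≤ I := integral_nonneg fun t => abs_nonneg _
  by_contra hne
  have hpos : 0 < |∫ t, Real.exp (-1 * t ^ 2) * A t * h (Real.exp (-1 * t ^ 2))| :=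
    abs_pos.2 hne
  set J := |∫ t, Real.exp (-1 * t ^ 2) * A t * h (Real.exp (-1 * t ^ 2))| with hJ
  obtain ⟨p, hp⟩ := exists_polynomial_near_of_continuousOn 0 1 h hh.continuousOn (J / (I + 1))
    (by positivity)
  have hp0 := integral_exp_neg_sq_mul_polynomial_eq_zero hA hM h0 p
  have hle : J ≤ ∫ t, |Real.exp (-1 * t ^ 2) * A t| * (J / (I + 1)) := by
    have hJ' : J = |∫ t, (Real.exp (-1 * t ^ 2) * A t * h (Real.exp (-1 * t ^ 2)) -
        Real.exp (-1 * t ^ 2) * A t * p.eval (Real.exp (-1 * t ^ 2)))| := by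
      rw [integral_sub (hbd _ hh) (hbd _ p.continuous), hp0, sub_zero]
    refine hJ'.le.trans ?_
    refine (abs_integral_le_integral_abs).trans (integral_mono_of_nonneg
      (ae_of_all _ fun t => abs_nonneg _) (hInt.abs.mul_const _) (ae_of_all _ fun t => ?_))
    simp only
    rw [← mul_sub, abs_mul]
    refine mul_le_mul_of_nonneg_left ?_ (abs_nonneg _)
    rw [abs_sub_comm]
    exact (hp _ (hmem t)).le
  rw [integral_mul_const, ← hI, mul_div_assoc', le_div_iff₀ (by positivity)] at hle
  nlinarith

lemma not_eventually_pos_of_integral_exp_neg_sq_eq_zero (hA : AEStronglyMeasurable A)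
    (hM : ∀ t, |A t| ≤ M)
    (h0 : ∀ s : ℝ, 0 < s → ∫ t, Real.exp (-s * t ^ 2) * A t = 0) :
    ¬ ∀ᶠ t in atTop, 0 < A t + A (-t) := by
  intro hev
  obtain ⟨T, hT⟩ := eventually_atTop.1 (hev.and (eventually_ge_atTop 0))
  have hT0 : 0 ≤ T := (hT T le_rfl).2
  let h : ℝ → ℝ := fun z => max 0 (Real.exp (-1 * T ^ 2) - z)
  have hh : Continuous h := by fun_prop
  have hh0 : ∀ z, 0 ≤ h z := fun z => le_max_left _ _
  have hz := integral_exp_neg_sq_mul_continuous_eq_zero hA hM h0 hh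
  have hbd : Integrable fun t => Real.exp (-1 * t ^ 2) * A t * h (Real.exp (-1 * t ^ 2)) := by
    obtain ⟨K, hK⟩ := isCompact_Icc.exists_bound_of_continuousOn
      (hh.continuousOn (s := Set.Icc (0 : ℝ) 1))
    exact (integrable_exp_neg_sq_mul hA hM one_pos).mul_bdd (c := K) (by fun_prop)
      (ae_of_all _ fun t =>
        hK _ ⟨(Real.exp_pos _).le, Real.exp_le_one_iff.2 (by nlinarith [sq_nonneg t])⟩)
  have hz' := hz
  rw [← integral_neg_eq_self] at hz'
  have hbd' := hbd.comp_neg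
  have hsum : ∫ t, Real.exp (-1 * t ^ 2) * (A t + A (-t)) * h (Real.exp (-1 * t ^ 2)) = 0 := by
    have e := integral_add hbd hbd'
    rw [hz, hz', add_zero] at e
    refine Eq.trans (integral_congr_ae (ae_of_all _ fun t => ?_)) e
    simp only [neg_sq]
    ring
  have hsupp : ∀ t, T < |t| ↔ h (Real.exp (-1 * t ^ 2)) ≠ 0 := by
    intro t
    have : T < |t| ↔ T ^ 2 < t ^ 2 := by
      rw [← sq_abs t]
      exact (pow_lt_pow_iff_left₀ hT0 (abs_nonneg t) two_ne_zero).symm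
    rw [this]
    constructor
    · intro hlt
      have : 0 < Real.exp (-1 * T ^ 2) - Real.exp (-1 * t ^ 2) :=
        sub_pos.2 (Real.exp_lt_exp.2 (by linarith))
      exact (lt_max_of_lt_right this).ne'
    · intro hne
      by_contra hle
      apply hne
      refine max_eq_left (sub_nonpos.2 (Real.exp_le_exp.2 (by linarith)))
  have hG : ∀ t, T < |t| → 0 < A t + A (-t) := by
    intro t ht
    rcases le_total 0 t with h | h
    · rw [abs_of_nonneg h] at ht
      exact (hT t ht.le).1
    · rw [abs_of_nonpos h] at ht
      have := (hT (-t) ht.le).1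
      rw [neg_neg] at this
      linarith
  have hInt : Integrable fun t =>
      Real.exp (-1 * t ^ 2) * (A t + A (-t)) * h (Real.exp (-1 * t ^ 2)) := by
    refine (hbd.add hbd').congr (ae_of_all _ fun t => ?_)
    simp only [neg_sq, Pi.add_apply]
    ring
  have hnn : 0 ≤ fun t => Real.exp (-1 * t ^ 2) * (A t + A (-t)) * h (Real.exp (-1 * t ^ 2)) := by
    intro t
    by_cases ht : T < |t|
    · exact mul_nonneg (mul_nonneg (Real.exp_pos _).le (hG t ht).le) (hh0 _)
    · have : h (Real.exp (-1 * t ^ 2)) = 0 := not_not.1 fun hc => ht ((hsupp t).2 hc)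
      simp only [Pi.zero_apply, this, mul_zero, le_refl]
  have hpos := (integral_pos_iff_support_of_nonneg hnn hInt).2 (by
    refine lt_of_lt_of_le ?_ (measure_mono (s := Set.Ioi T) ?_)
    · simp
    · intro t ht
      have ht' : T < |t| := lt_of_lt_of_le ht (le_abs_self t)
      exact mul_ne_zero (mul_ne_zero (Real.exp_pos _).ne' (hG t ht').ne') ((hsupp t).1 ht'))
  exact hpos.ne' hsum

lemma limit_eq_zero_of_integral_exp_neg_sq_eq_zero (hA : AEStronglyMeasurable A)
    (hM : ∀ t, |A t| ≤ M)
    (h0 : ∀ s : ℝ, 0 < s → ∫ t, Real.exp (-s * t ^ 2) * A t = 0) {w : ℝ → ℝ}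
    (hw : ∀ t, 0 < w t) {ℓ : ℝ} (hℓ : Tendsto (fun t => w t * (A t + A (-t))) atTop (𝓝 ℓ)) :
    ℓ = 0 := by
  have key : ∀ B : ℝ → ℝ, AEStronglyMeasurable B → (∀ t, |B t| ≤ M) →
      (∀ s : ℝ, 0 < s → ∫ t, Real.exp (-s * t ^ 2) * B t = 0) → ∀ ℓ : ℝ,
      Tendsto (fun t => w t * (B t + B (-t))) atTop (𝓝 ℓ) → ℓ ≤ 0 := by
    intro B hB hM h0 ℓ hℓ
    by_contra hpos
    refine not_eventually_pos_of_integral_exp_neg_sq_eq_zero hB hM h0 ?_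
    filter_upwards [hℓ.eventually (lt_mem_nhds (not_le.1 hpos))] with t ht
    exact pos_of_mul_pos_right ht (hw t).le
  refine le_antisymm (key A hA hM h0 ℓ hℓ) ?_
  have := key (fun t => -A t) hA.neg (by simpa using hM)
    (fun s hs => by simp only [mul_neg, integral_neg, h0 s hs, neg_zero]) (-ℓ) (by
      refine hℓ.neg.congr fun t => ?_
      ring)
  linarith

end LaplaceUniqueness

section Funk

variable {H : Type*} [NormedAddCommGroup H] [InnerProductSpace ℝ H] [FiniteDimensional ℝ H]
  [MeasurableSpace H] [BorelSpace H]

lemma tendsto_integral_cone {Φ : H × ℝ → ℝ} (hm : Measurable Φ) {C R : ℝ} (hR0 : 0 ≤ R)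
    (hC : ∀ x, |Φ x| ≤ C) (hR : ∀ y t, R ^ 2 < ‖y‖ ^ 2 + t ^ 2 → Φ (y, t) = 0) (ε : ℝ)
    (hε : ε ^ 2 = 1) (hc : ∀ᵐ z : H, ContinuousAt Φ (0, ε * ‖z‖)) :
    Tendsto (fun τ : ℝ => |((√(1 + τ ^ 2))⁻¹ ^ Module.finrank ℝ H)⁻¹| *
      ∫ y : H, Φ (y, (ε * τ) * ‖y‖)) atTop (𝓝 (∫ z : H, Φ (0, ε * ‖z‖))) := by
  have hq : ∀ τ : ℝ, 0 < √(1 + τ ^ 2) := fun τ => Real.sqrt_pos.2 (by positivity)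
  have key : ∀ τ : ℝ, |((√(1 + τ ^ 2))⁻¹ ^ Module.finrank ℝ H)⁻¹| *
      ∫ y : H, Φ (y, (ε * τ) * ‖y‖) =
      ∫ z : H, Φ ((√(1 + τ ^ 2))⁻¹ • z, ε * ((τ * (√(1 + τ ^ 2))⁻¹) * ‖z‖)) := by
    intro τ
    have := Measure.integral_comp_smul (volume : Measure H)
      (fun y => Φ (y, (ε * τ) * ‖y‖)) (√(1 + τ ^ 2))⁻¹
    rw [smul_eq_mul] at this
    rw [← this]
    congr 1 with z
    rw [norm_smul, Real.norm_of_nonneg (inv_nonneg.2 (hq τ).le)]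
    congr 2; ring
  simp_rw [key]
  refine tendsto_integral_filter_of_dominated_convergence
    ((closedBall (0 : H) R).indicator fun _ => C) (.of_forall fun τ => ?_)
    (.of_forall fun τ => .of_forall fun z => ?_) ?_ ?_
  · exact (hm.comp (by fun_prop)).aestronglyMeasurable
  · by_cases hz : ‖z‖ ≤ R
    · rw [Set.indicator_of_mem (by simpa using hz)]
      exact hC _
    · rw [Set.indicator_of_notMem (by simpa using hz), hR, norm_zero]
      rw [norm_smul, Real.norm_of_nonneg (inv_nonneg.2 (hq τ).le)]
      have h1 : (√(1 + τ ^ 2))⁻¹ ^ 2 * (1 + τ ^ 2) = 1 := by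
        rw [inv_pow, Real.sq_sqrt (by positivity)]
        exact inv_mul_cancel₀ (by positivity)
      have h2 : ((√(1 + τ ^ 2))⁻¹ * ‖z‖) ^ 2 + (ε * (τ * (√(1 + τ ^ 2))⁻¹ * ‖z‖)) ^ 2
          = ‖z‖ ^ 2 := by
        linear_combination ((√(1 + τ ^ 2))⁻¹ ^ 2 * τ^2 * ‖z‖^2) * hε + ‖z‖ ^ 2 * h1
      rw [h2]
      push Not at hz
      gcongr
  · rw [integrable_indicator_iff measurableSet_closedBall]
    exact integrableOn_const (isCompact_closedBall _ _).measure_lt_top.ne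
  · filter_upwards [hc] with z hz
    have h1 : Tendsto (fun τ : ℝ => (√(1 + τ ^ 2))⁻¹) atTop (𝓝 0) := by
      apply Tendsto.inv_tendsto_atTop
      refine tendsto_atTop_mono (fun τ => ?_) tendsto_id
      exact (le_abs_self τ).trans (by rw [← Real.sqrt_sq_eq_abs]; gcongr; linarith)
    have h2 : Tendsto (fun τ : ℝ => τ * (√(1 + τ ^ 2))⁻¹) atTop (𝓝 1) := by
      have h3 : Tendsto (fun τ : ℝ => √(1 - (√(1 + τ ^ 2))⁻¹ ^ 2)) atTop (𝓝 (√(1 - 0 ^ 2))) :=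
        (((h1.pow 2).const_sub 1).sqrt)
      simp only [ne_eq, OfNat.ofNat_ne_zero, not_false_eq_true, zero_pow, sub_zero,
        Real.sqrt_one] at h3
      refine h3.congr' ?_
      filter_upwards [eventually_ge_atTop 0] with τ hτ
      rw [← Real.sqrt_sq (mul_nonneg hτ (inv_nonneg.2 (hq τ).le))]
      congr 1
      rw [mul_pow, inv_pow, Real.sq_sqrt (by positivity)]
      field_simp
      ring
    have h3 : Tendsto (fun τ : ℝ => ((√(1 + τ ^ 2))⁻¹ • z, ε * ((τ * (√(1 + τ ^ 2))⁻¹) * ‖z‖)))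
        atTop (𝓝 ((0 : ℝ) • z, ε * (1 * ‖z‖))) :=
      (h1.smul_const z).prodMk_nhds ((h2.mul_const _).const_mul _)
    rw [zero_smul, one_mul] at h3
    exact hz.tendsto.comp h3

/-- A Funk-type uniqueness statement: a bounded function with bounded support on `H × ℝ`
whose integrals over the graphs of all linear functionals vanish also has vanishing
symmetrized radial integral along the vertical axis. -/
lemma integral_vertical_eq_zero {Φ : H × ℝ → ℝ} (hm : Measurable Φ) {C R : ℝ} (hR0 : 0 ≤ R)
    (hC : ∀ x, |Φ x| ≤ C) (hR : ∀ y t, R ^ 2 < ‖y‖ ^ 2 + t ^ 2 → Φ (y, t) = 0)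
    (h0 : ∀ a : H, ∫ y, Φ (y, ⟪a, y⟫) = 0)
    (hc : ∀ᵐ z : H, ContinuousAt Φ (0, ‖z‖)) (hc' : ∀ᵐ z : H, ContinuousAt Φ (0, -‖z‖)) :
    (∫ z : H, Φ (0, ‖z‖)) + ∫ z : H, Φ (0, -‖z‖) = 0 := by
  have hR' : ∀ y t, R < ‖y‖ → Φ (y, t) = 0 := fun y t h => hR y t <| by
    nlinarith [sq_nonneg t]
  have hmeas : AEStronglyMeasurable fun t : ℝ => ∫ y : H, Φ (y, t * ‖y‖) := by
    refine (StronglyMeasurable.integral_prod_right'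
      (f := fun p : ℝ × H => Φ (p.2, p.1 * ‖p.2‖)) ?_).aestronglyMeasurable
    exact (hm.comp (by fun_prop)).stronglyMeasurable
  have hbd : ∀ t : ℝ, |∫ y : H, Φ (y, t * ‖y‖)| ≤
      ∫ y : H, (closedBall (0 : H) R).indicator (fun _ => C) y := by
    intro t
    rw [← Real.norm_eq_abs]
    refine norm_integral_le_of_norm_le ?_ (.of_forall fun z => ?_)
    · rw [integrable_indicator_iff measurableSet_closedBall]
      exact integrableOn_const (isCompact_closedBall _ _).measure_lt_top.ne
    · by_cases hz : ‖z‖ ≤ R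
      · rw [Set.indicator_of_mem (by simpa using hz)]
        exact hC _
      · rw [Set.indicator_of_notMem (by simpa using hz), hR' _ _ (not_le.1 hz), norm_zero]
  refine limit_eq_zero_of_integral_exp_neg_sq_eq_zero hmeas hbd
    (fun s hs => integral_exp_neg_sq_cone_eq_zero hm hC hR' h0 hs)
    (w := fun τ => |((√(1 + τ ^ 2))⁻¹ ^ Module.finrank ℝ H)⁻¹|) (fun τ => ?_) ?_
  · have : 0 < √(1 + τ ^ 2) := Real.sqrt_pos.2 (by positivity)
    positivity
  · have h1 := tendsto_integral_cone hm hR0 hC hR 1 (by norm_num) (by simpa using hc)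
    have h2 := tendsto_integral_cone hm hR0 hC hR (-1) (by norm_num) (by simpa using hc')
    simpa only [one_mul, neg_mul, mul_add] using h1.add h2

end Funk

section Sections

variable {E H : Type*} [NormedAddCommGroup E] [InnerProductSpace ℝ E]
  [NormedAddCommGroup H] [InnerProductSpace ℝ H] {ι : H →ₗᵢ[ℝ] E} {u₀ : E}

lemma exists_linearIsometryEquiv_apply_eq {v w : E} (h : ‖v‖ = ‖w‖) :
    ∃ g : E ≃ₗᵢ[ℝ] E, g v = w :=
  ⟨_, Submodule.reflection_sub h⟩

lemma exists_graph_eq_isometry (hu₀ : ‖u₀‖ = 1) (hι : ∀ x, (∃ y, ι y = x) ↔ ⟪u₀, x⟫ = 0) (a : H) :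
    ∃ (g : E ≃ₗᵢ[ℝ] E) (M : H →ₗ[ℝ] H), Function.Injective M ∧
      ∀ y, ι y + ⟪a, y⟫ • u₀ = g (ι (M y)) := by
  have hort : ∀ y, ⟪u₀, ι y⟫ = 0 := fun y => (hι _).1 ⟨y, rfl⟩
  have hort' : ∀ y, ⟪ι y, u₀⟫ = 0 := fun y => by rw [real_inner_comm, hort]
  have h1 : ⟪u₀, u₀⟫ = 1 := by rw [real_inner_self_eq_norm_sq, hu₀]; norm_num
  have hne : u₀ - ι a ≠ 0 := by
    intro h
    have : ⟪u₀, u₀ - ι a⟫ = 0 := by rw [h, inner_zero_right]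
    rw [inner_sub_right, h1, hort] at this
    norm_num at this
  have hpos : 0 < ‖u₀ - ι a‖ := norm_pos_iff.2 hne
  obtain ⟨g, hg⟩ := exists_linearIsometryEquiv_apply_eq (v := u₀) (w := ‖u₀ - ι a‖⁻¹ • (u₀ - ι a))
    (by rw [norm_smul, norm_inv, norm_norm, inv_mul_cancel₀ hpos.ne', hu₀])
  obtain ⟨l, hl⟩ := LinearMap.exists_leftInverse_of_injective ι.toLinearMap
    (LinearMap.ker_eq_bot.2 ι.injective)
  have hl' : ∀ y, l (ι y) = y := fun y => by
    simpa using congrArg (fun f => f y) hl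
  let G : H →ₗ[ℝ] E := ι.toLinearMap + ((innerSL ℝ a).toLinearMap).smulRight u₀
  have hG : ∀ y, G y = ι y + ⟪a, y⟫ • u₀ := fun y => by simp [G]
  have hmem : ∀ y, ∃ w, ι w = g.symm (G y) := by
    intro y
    rw [hι, ← g.inner_map_map, g.apply_symm_apply, hg, hG, inner_smul_left, inner_sub_left,
      inner_add_right, inner_add_right, inner_smul_right, inner_smul_right, h1, hort, hort',
      ι.inner_map_map]
    simp
  have hM : ∀ y, ι (l (g.symm (G y))) = g.symm (G y) := by
    intro y
    obtain ⟨w, hw⟩ := hmem y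
    rw [← hw, hl']
  refine ⟨g, l ∘ₗ g.symm.toLinearEquiv.toLinearMap ∘ₗ G, ?_, fun y => ?_⟩
  · rw [injective_iff_map_eq_zero]
    intro y hy
    have h2 : G y = 0 := by
      have := hM y
      rw [show l (g.symm (G y)) = 0 from hy, map_zero] at this
      exact (g.symm.map_eq_zero_iff).1 this.symm
    have h3 : ⟪ι y, G y⟫ = 0 := by rw [h2, inner_zero_right]
    rw [hG, inner_add_right, inner_smul_right, hort', mul_zero, add_zero,
      inner_self_eq_zero] at h3
    exact ι.injective (by rw [h3, map_zero])
  · have := hM y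
    rw [← hG]
    exact (g.symm.injective (by rw [g.symm_apply_apply]; exact hM y)).symm

variable [FiniteDimensional ℝ H] [MeasurableSpace H] [BorelSpace H]
  [MeasurableSpace E] [BorelSpace E]

lemma integral_comp_injective_linearMap {M : H →ₗ[ℝ] H} (hM : Function.Injective M) (f : H → ℝ) :
    ∫ y, f (M y) = |(LinearMap.det M)⁻¹| * ∫ y, f y := by
  have hu : IsUnit (LinearMap.det M) := by
    refine LinearMap.isUnit_det M ?_
    rw [LinearMap.isUnit_iff_ker_eq_bot]
    exact LinearMap.ker_eq_bot.2 hM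
  have h := Measure.map_linearMap_addHaar_eq_smul_addHaar (volume : Measure H) hu.ne_zero
  have hemb : MeasurableEmbedding M :=
    (LinearMap.continuous_of_finiteDimensional M).measurableEmbedding hM
  rw [← hemb.integral_map, h, integral_smul_measure, ENNReal.toReal_ofReal (abs_nonneg _),
    smul_eq_mul]

/-- If the integral of `F` over all rotated copies of the hyperplane `range ι` is constant,
the symmetrized radial integral of `F` does not depend on the direction. -/
lemma radial_integral_eq [FiniteDimensional ℝ E]
    (hu₀ : ‖u₀‖ = 1) (hι : ∀ x, (∃ y, ι y = x) ↔ ⟪u₀, x⟫ = 0)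
    {F : E → ℝ} (hm : Measurable F) {C R J : ℝ} (hR0 : 0 ≤ R) (hC : ∀ x, |F x| ≤ C)
    (hR : ∀ x, R < ‖x‖ → F x = 0) (hJ : ∀ g : E ≃ₗᵢ[ℝ] E, ∫ y, F (g (ι y)) = J)
    (hc : ∀ u : E, ‖u‖ = 1 → ∀ᵐ z : H, ContinuousAt F (‖z‖ • u)) {u : E} (hu : ‖u‖ = 1) :
    (∫ z : H, F (‖z‖ • u)) + ∫ z : H, F (‖z‖ • (-u)) =
      (∫ z : H, F (‖z‖ • u₀)) + ∫ z : H, F (‖z‖ • (-u₀)) := by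
  have hort : ∀ y, ⟪u₀, ι y⟫ = 0 := fun y => (hι _).1 ⟨y, rfl⟩
  have hort' : ∀ y, ⟪ι y, u₀⟫ = 0 := fun y => by rw [real_inner_comm, hort]
  obtain ⟨g, hg⟩ := exists_linearIsometryEquiv_apply_eq (hu₀.trans hu.symm)
  have hInt : ∀ (T : H → E), Measurable T → (∀ y, ‖y‖ ≤ ‖T y‖) → Integrable fun y => F (T y) := by
    intro T hT hn
    refine Integrable.mono' (g := (closedBall (0 : H) R).indicator fun _ => C) ?_
      (hm.comp hT).aestronglyMeasurable (.of_forall fun z => ?_)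
    · rw [integrable_indicator_iff measurableSet_closedBall]
      exact integrableOn_const (isCompact_closedBall _ _).measure_lt_top.ne
    · by_cases hz : ‖z‖ ≤ R
      · rw [Set.indicator_of_mem (by simpa using hz)]
        exact hC _
      · rw [Set.indicator_of_notMem (by simpa using hz), hR _ ((not_le.1 hz).trans_le (hn z)),
          norm_zero]
  let P : H × ℝ → E := fun p => ι p.1 + p.2 • u₀
  have hPc : Continuous P := by
    have := ι.continuous
    fun_prop
  have hPn : ∀ y t, ‖P (y, t)‖ ^ 2 = ‖y‖ ^ 2 + t ^ 2 := by
    intro y t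
    rw [norm_add_sq_real, inner_smul_right, hort', norm_smul, hu₀, ι.norm_map,
      Real.norm_eq_abs, mul_one, sq_abs]
    ring
  have hPn' : ∀ y t, ‖y‖ ≤ ‖P (y, t)‖ := fun y t =>
    le_of_pow_le_pow_left₀ two_ne_zero (norm_nonneg _) (by rw [hPn]; nlinarith [sq_nonneg t])
  have hgc : Continuous g := g.continuous
  have h0 : ∀ a : H, ∫ y, (F (P (y, ⟪a, y⟫)) - F (g (P (y, ⟪a, y⟫)))) = 0 := by
    intro a
    obtain ⟨ga, M, hMi, hM⟩ := exists_graph_eq_isometry hu₀ hι a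
    rw [integral_sub]
    · simp only [P, hM]
      rw [integral_comp_injective_linearMap hMi (fun y => F (ga (ι y))),
        integral_comp_injective_linearMap hMi (fun y => F (g (ga (ι y)))), hJ ga]
      have := hJ (ga.trans g)
      simp only [LinearIsometryEquiv.coe_trans, Function.comp_apply] at this
      rw [this, sub_self]
    · exact hInt _ (hPc.measurable.comp (by fun_prop)) fun y => hPn' _ _
    · exact hInt (fun y => g (P (y, ⟪a, y⟫)))
        (hgc.measurable.comp (hPc.measurable.comp (by fun_prop)))
        fun y => by rw [g.norm_map]; exact hPn' _ _
  have hP0 : ∀ t, P (0, t) = t • u₀ := fun t => by simp [P]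
  have hR1 : ∀ y t, R ^ 2 < ‖y‖ ^ 2 + t ^ 2 → R < ‖P (y, t)‖ := fun y t h =>
    lt_of_pow_lt_pow_left₀ 2 (norm_nonneg _) (by rwa [hPn])
  have hcg : ∀ x : H × ℝ, ContinuousAt F (P x) → ContinuousAt F (g (P x)) →
      ContinuousAt (fun p => F (P p) - F (g (P p))) x := fun x h1 h2 =>
    (ContinuousAt.comp (f := P) h1 hPc.continuousAt).sub
      (ContinuousAt.comp (f := fun p => g (P p)) h2 (hgc.comp hPc).continuousAt)
  have key := integral_vertical_eq_zero (Φ := fun p => F (P p) - F (g (P p)))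
    ((hm.comp hPc.measurable).sub (hm.comp (hgc.comp hPc).measurable)) (C := C + C) hR0
    (fun x => (abs_sub _ _).trans (add_le_add (hC _) (hC _)))
    (fun y t h => by rw [hR _ (hR1 y t h), hR _ (by rw [g.norm_map]; exact hR1 y t h), sub_zero])
    h0 ?_ ?_
  · have hi : ∀ v : E, ‖v‖ = 1 → Integrable fun z : H => F (‖z‖ • v) := fun v hv =>
      hInt _ (by fun_prop) fun y => by rw [norm_smul, norm_norm, hv, mul_one]
    simp only [hP0, map_smul, hg, neg_smul, map_neg] at key
    simp only [← smul_neg] at key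
    rw [integral_sub (hi _ hu₀) (hi _ hu), integral_sub (hi _ (by rwa [norm_neg]))
      (hi _ (by rwa [norm_neg]))] at key
    linarith
  · filter_upwards [hc u₀ hu₀, hc u hu] with z h1 h2
    refine hcg _ ?_ ?_
    · rwa [hP0]
    · rwa [hP0, map_smul, hg]
  · filter_upwards [hc (-u₀) (by rwa [norm_neg]), hc (-u) (by rwa [norm_neg])] with z h1 h2
    refine hcg _ ?_ ?_
    · rwa [hP0, neg_smul, ← smul_neg]
    · rwa [hP0, map_smul, hg, neg_smul, ← smul_neg]

end Sections

section Body

variable {E H : Type*} [NormedAddCommGroup E] [InnerProductSpace ℝ E] {B : Set E}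

lemma gauge_le_one_iff_mem (hBc : IsCompact B) (hBv : Convex ℝ B) (hB0 : 0 ∈ interior B) {x : E} :
    gauge B x ≤ 1 ↔ x ∈ B := by
  rw [gauge_le_one_iff_mem_closure hBv (mem_interior_iff_mem_nhds.1 hB0),
    hBc.isClosed.closure_eq]

lemma gauge_pos_of_ne_zero (hBc : IsCompact B) (hB0 : 0 ∈ interior B) {x : E} (hx : x ≠ 0) :
    0 < gauge B x :=
  (gauge_pos (absorbent_nhds_zero (mem_interior_iff_mem_nhds.1 hB0))
    ((NormedSpace.isVonNBounded_iff ℝ).2 hBc.isBounded)).2 hx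

lemma smul_mem_iff_le_inv_gauge (hBc : IsCompact B) (hBv : Convex ℝ B) (hB0 : 0 ∈ interior B)
    {x : E} (hx : x ≠ 0) {s : ℝ} (hs : 0 ≤ s) : s • x ∈ B ↔ s ≤ (gauge B x)⁻¹ := by
  rw [← gauge_le_one_iff_mem hBc hBv hB0, gauge_smul_of_nonneg hs, smul_eq_mul,
    ← one_div, le_div_iff₀ (gauge_pos_of_ne_zero hBc hB0 hx)]

lemma smul_mem_iff_neg_le_and_le (hBc : IsCompact B) (hBv : Convex ℝ B) (hB0 : 0 ∈ interior B)
    {x : E} (hx : x ≠ 0) (s : ℝ) :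
    s • x ∈ B ↔ -(gauge B (-x))⁻¹ ≤ s ∧ s ≤ (gauge B x)⁻¹ := by
  have h1 := gauge_pos_of_ne_zero hBc hB0 hx
  have h2 := gauge_pos_of_ne_zero hBc hB0 (neg_ne_zero.2 hx)
  have h1' := inv_pos.2 h1
  have h2' := inv_pos.2 h2
  rcases le_total 0 s with hs | hs
  · rw [smul_mem_iff_le_inv_gauge hBc hBv hB0 hx hs]
    exact ⟨fun h => ⟨by linarith, h⟩, fun h => h.2⟩
  · rw [← neg_smul_neg, smul_mem_iff_le_inv_gauge hBc hBv hB0 (neg_ne_zero.2 hx) (neg_nonneg.2 hs)]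
    exact ⟨fun h => ⟨by linarith, by linarith⟩, fun h => by linarith [h.1]⟩

lemma continuousAt_indicator_norm_pow (hBc : IsCompact B) (hBv : Convex ℝ B)
    (hB0 : 0 ∈ interior B) (m : ℕ) {x : E} (hx : gauge B x ≠ 1) :
    ContinuousAt (B.indicator fun x => ‖x‖ ^ m) x := by
  have hcont := continuous_gauge hBv (mem_interior_iff_mem_nhds.1 hB0)
  rcases lt_or_gt_of_ne hx with h | h
  · have h1 : ContinuousAt (fun x : E => ‖x‖ ^ m) x := by fun_prop
    refine h1.congr ?_
    filter_upwards [hcont.continuousAt.eventually_lt continuousAt_const h] with y hy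
    rw [Set.indicator_of_mem ((gauge_le_one_iff_mem hBc hBv hB0).1 hy.le)]
  · refine (continuousAt_const (y := (0 : ℝ))).congr ?_
    filter_upwards [continuousAt_const.eventually_lt hcont.continuousAt h] with y hy
    rw [Set.indicator_of_notMem fun h => (((gauge_le_one_iff_mem hBc hBv hB0).2 h).not_gt hy)]

variable [NormedAddCommGroup H] [InnerProductSpace ℝ H] {ι : H →ₗᵢ[ℝ] E} {u₀ : E}
  [FiniteDimensional ℝ H] [MeasurableSpace H] [BorelSpace H]

lemma integral_indicator_norm_smul (hBc : IsCompact B) (hBv : Convex ℝ B)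
    (hB0 : 0 ∈ interior B) (m : ℕ) {u : E} (hu : ‖u‖ = 1) :
    ∫ z : H, B.indicator (fun x => ‖x‖ ^ m) (‖z‖ • u) =
      (gauge B u)⁻¹ ^ (Module.finrank ℝ H + m) *
        ∫ z : H, (closedBall (0 : H) 1).indicator (fun z => ‖z‖ ^ m) z := by
  have hu' : u ≠ 0 := norm_pos_iff.1 (by rw [hu]; norm_num)
  have hp := gauge_pos_of_ne_zero hBc hB0 hu'
  have h1 : ∀ z : H, B.indicator (fun x => ‖x‖ ^ m) (‖z‖ • u) = (gauge B u)⁻¹ ^ m *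
      (closedBall (0 : H) 1).indicator (fun z => ‖z‖ ^ m) (gauge B u • z) := by
    intro z
    have h2 : ‖z‖ • u ∈ B ↔ gauge B u • z ∈ closedBall (0 : H) 1 := by
      rw [← gauge_le_one_iff_mem hBc hBv hB0, gauge_smul_of_nonneg (norm_nonneg z),
        mem_closedBall_zero_iff, norm_smul, Real.norm_of_nonneg hp.le, smul_eq_mul, mul_comm]
    by_cases hz : ‖z‖ • u ∈ B
    · rw [Set.indicator_of_mem hz, Set.indicator_of_mem (h2.1 hz), norm_smul, norm_smul, hu,
        norm_norm, Real.norm_of_nonneg hp.le, ← mul_pow, ← mul_assoc, inv_mul_cancel₀ hp.ne']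
      ring
    · rw [Set.indicator_of_notMem hz, Set.indicator_of_notMem (h2.not.1 hz), mul_zero]
  simp_rw [h1]
  rw [integral_const_mul, Measure.integral_comp_smul, smul_eq_mul, ← mul_assoc]
  congr 1
  rw [abs_of_pos (by positivity), pow_add, inv_pow, inv_pow, mul_comm]

lemma integral_closedBall_norm_pow_pos [Nontrivial H] (m : ℕ) :
    0 < ∫ z : H, (closedBall (0 : H) 1).indicator (fun z => ‖z‖ ^ m) z := by
  rw [integral_pos_iff_support_of_nonneg]
  · refine lt_of_lt_of_le (IsOpen.measure_pos volume (U := ball (0 : H) 1 ∩ {0}ᶜ)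
      (isOpen_ball.inter isOpen_compl_singleton) ?_) (measure_mono ?_)
    · obtain ⟨x, hx⟩ := exists_norm_eq H (show (0 : ℝ) ≤ 1 / 2 by norm_num)
      refine ⟨x, by simp [hx]; norm_num, fun h => ?_⟩
      rw [Set.mem_singleton_iff.1 h, norm_zero] at hx
      norm_num at hx
    · intro x hx
      rw [Function.mem_support, Set.indicator_of_mem (ball_subset_closedBall hx.1)]
      exact pow_ne_zero _ (norm_ne_zero_iff.2 hx.2)
  · exact Set.indicator_nonneg fun x _ => by positivity
  · rw [integrable_indicator_iff measurableSet_closedBall]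
    exact ContinuousOn.integrableOn_compact (isCompact_closedBall _ _) (by fun_prop)

variable [MeasurableSpace E] [BorelSpace E] in
lemma inv_gauge_pow_add_eq_of_section_integral_eq [FiniteDimensional ℝ E] [Nontrivial H]
    (hBc : IsCompact B) (hBv : Convex ℝ B) (hB0 : 0 ∈ interior B)
    (hu₀ : ‖u₀‖ = 1) (hι : ∀ x, (∃ y, ι y = x) ↔ ⟪u₀, x⟫ = 0) (m : ℕ) {J : ℝ}
    (hJ : ∀ g : E ≃ₗᵢ[ℝ] E, ∫ y, B.indicator (fun x => ‖x‖ ^ m) (g (ι y)) = J) {u : E}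
    (hu : ‖u‖ = 1) :
    (gauge B u)⁻¹ ^ (Module.finrank ℝ H + m) + (gauge B (-u))⁻¹ ^ (Module.finrank ℝ H + m) =
      (gauge B u₀)⁻¹ ^ (Module.finrank ℝ H + m) +
        (gauge B (-u₀))⁻¹ ^ (Module.finrank ℝ H + m) := by
  obtain ⟨R, hR⟩ := hBc.isBounded.subset_closedBall 0
  have hR0 : 0 ≤ R := by simpa using hR (interior_subset hB0)
  have h := radial_integral_eq (F := B.indicator fun x => ‖x‖ ^ m) (C := R ^ m) hu₀ hι
    ((by fun_prop : Measurable fun x : E => ‖x‖ ^ m).indicator hBc.measurableSet) hR0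
    (fun x => ?_) (fun x hx => ?_) hJ (fun v hv => ?_) hu
  · rw [integral_indicator_norm_smul hBc hBv hB0 m hu,
      integral_indicator_norm_smul hBc hBv hB0 m hu₀,
      integral_indicator_norm_smul hBc hBv hB0 m (by rwa [norm_neg]),
      integral_indicator_norm_smul hBc hBv hB0 m (by rwa [norm_neg]), ← add_mul, ← add_mul] at h
    exact mul_right_cancel₀ (integral_closedBall_norm_pow_pos m).ne' h
  · by_cases hx : x ∈ B
    · rw [Set.indicator_of_mem hx, abs_of_nonneg (by positivity)]
      have : ‖x‖ ≤ R := by simpa using hR hx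
      gcongr
    · rw [Set.indicator_of_notMem hx, abs_zero]
      positivity
  · refine Set.indicator_of_notMem (fun h => ?_) _
    have : ‖x‖ ≤ R := by simpa using hR h
    linarith
  · have hs : ∀ᵐ z : H, z ∉ sphere (0 : H) (gauge B v)⁻¹ :=
      measure_eq_zero_iff_ae_notMem.1 (Measure.addHaar_sphere _ _ _)
    filter_upwards [hs] with z hz
    refine continuousAt_indicator_norm_pow hBc hBv hB0 m fun h => hz ?_
    rw [gauge_smul_of_nonneg (norm_nonneg z), smul_eq_mul] at h
    rw [mem_sphere_zero_iff_norm]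
    exact eq_inv_of_mul_eq_one_left h

end Body

section Congruence

variable {E H : Type*} [NormedAddCommGroup E] [InnerProductSpace ℝ E] {B : Set E}
  [NormedAddCommGroup H] [InnerProductSpace ℝ H] {ι : H →ₗᵢ[ℝ] E} {u₀ : E}

lemma exists_restrict_linearIsometryEquiv [FiniteDimensional ℝ H]
    (hι : ∀ x, (∃ y, ι y = x) ↔ ⟪u₀, x⟫ = 0) (k : E ≃ₗᵢ[ℝ] E) (hk : ∀ y, ⟪u₀, k (ι y)⟫ = 0) :
    ∃ k₀ : H ≃ₗᵢ[ℝ] H, ∀ y, k (ι y) = ι (k₀ y) := by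
  obtain ⟨l, hl⟩ := LinearMap.exists_leftInverse_of_injective ι.toLinearMap
    (LinearMap.ker_eq_bot.2 ι.injective)
  have hl' : ∀ y, l (ι y) = y := fun y => by
    simpa using congrArg (fun f => f y) hl
  have h1 : ∀ y, ι (l (k (ι y))) = k (ι y) := by
    intro y
    obtain ⟨w, hw⟩ := (hι _).2 (hk y)
    rw [← hw, hl']
  let φ : H →ₗᵢ[ℝ] H :=
    { toLinearMap := l ∘ₗ k.toLinearEquiv.toLinearMap ∘ₗ ι.toLinearMap
      norm_map' := fun y => by
        rw [← ι.norm_map]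
        exact (congrArg norm (h1 y)).trans (by rw [k.norm_map, ι.norm_map]) }
  refine ⟨φ.toLinearIsometryEquiv rfl, fun y => ?_⟩
  exact (h1 y).symm

lemma exists_center_of_congruent [FiniteDimensional ℝ H]
    (hB0 : 0 ∈ interior B) (hι : ∀ x, (∃ y, ι y = x) ↔ ⟪u₀, x⟫ = 0) (g : E ≃ₗᵢ[ℝ] E)
    (hg : ∃ f : E ≃ᵢ E, f '' (B ∩ Set.range fun y => g (ι y)) = B ∩ Set.range ι) :
    ∃ (p : H) (k : H ≃ₗᵢ[ℝ] H), ∀ y, g (ι y) ∈ B ↔ ι (p + k y) ∈ B := by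
  obtain ⟨f, hf⟩ := hg
  let A : E ≃ᵃⁱ[ℝ] E := f.toRealAffineIsometryEquiv
  have hA : ∀ x, f x = A.linearIsometryEquiv x + f 0 := by
    intro x
    have := A.map_vadd 0 x
    simpa [A] using this
  have hmem : ∀ y, g (ι y) ∈ B → f (g (ι y)) ∈ B ∩ Set.range ι := fun y hy => by
    rw [← hf]
    exact ⟨_, ⟨hy, y, rfl⟩, rfl⟩
  obtain ⟨p, hp⟩ : ∃ p, ι p = f 0 := by
    have := hmem 0 (by simpa using interior_subset hB0)
    rw [map_zero, map_zero] at this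
    exact this.2
  have hp0 : ⟪u₀, f 0⟫ = 0 := (hι _).1 ⟨p, hp⟩
  obtain ⟨k, hk⟩ := exists_restrict_linearIsometryEquiv hι (g.trans A.linearIsometryEquiv) (by
    intro y
    have hev : ∀ᶠ t : ℝ in 𝓝 0, t • g (ι y) ∈ B := by
      have h1 : Tendsto (fun t : ℝ => t • g (ι y)) (𝓝 0) (𝓝 ((0 : ℝ) • g (ι y))) :=
        tendsto_id.smul_const _
      rw [zero_smul] at h1
      exact h1.eventually (mem_interior_iff_mem_nhds.1 hB0)
    obtain ⟨t, htB, ht⟩ := ((hev.filter_mono nhdsWithin_le_nhds).and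
      (self_mem_nhdsWithin (s := Set.Ioi (0 : ℝ)))).exists
    have h2 := (hmem (t • y) (by simpa using htB)).2
    have h3 := (hι _).1 h2
    rw [hA, inner_add_right, hp0, add_zero, map_smul, map_smul, map_smul, inner_smul_right] at h3
    exact (mul_eq_zero.1 h3).resolve_left (ne_of_gt ht))
  have hfk : ∀ y, f (g (ι y)) = ι (p + k y) := fun y => by
    rw [hA, map_add, hp, ← hk, add_comm]
    rfl
  refine ⟨p, k, fun y => ⟨fun h => ?_, fun h => ?_⟩⟩
  · rw [← hfk]
    exact (hmem y h).1
  · have h1 : ι (p + k y) ∈ B ∩ Set.range ι := ⟨h, _, rfl⟩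
    rw [← hf, ← hfk] at h1
    obtain ⟨x, hx, hxy⟩ := h1
    rw [← f.injective hxy]
    exact hx.1

variable [FiniteDimensional ℝ H] [MeasurableSpace H] [BorelSpace H]

lemma integral_section_eq_of_center {g : E ≃ₗᵢ[ℝ] E} {p : H} {k : H ≃ₗᵢ[ℝ] H}
    (h : ∀ y, g (ι y) ∈ B ↔ ι (p + k y) ∈ B) (m : ℕ) :
    ∫ y, B.indicator (fun x => ‖x‖ ^ m) (g (ι y)) =
      ∫ x, (ι ⁻¹' B).indicator (fun x => ‖x - p‖ ^ m) x := by
  have h1 : ∀ y, B.indicator (fun x => ‖x‖ ^ m) (g (ι y)) =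
      (ι ⁻¹' B).indicator (fun x => ‖x - p‖ ^ m) (p + k y) := by
    intro y
    by_cases hy : g (ι y) ∈ B
    · rw [Set.indicator_of_mem hy, Set.indicator_of_mem (show p + k y ∈ ι ⁻¹' B from (h y).1 hy)]
      simp
    · rw [Set.indicator_of_notMem hy,
        Set.indicator_of_notMem (show p + k y ∉ ι ⁻¹' B from (h y).not.1 hy)]
  simp_rw [h1]
  exact (k.measurePreserving.integral_comp' (f := k.toHomeomorph.toMeasurableEquiv)
    (fun y => (ι ⁻¹' B).indicator (fun x => ‖x - p‖ ^ m) (p + y))).trans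
    (integral_add_left_eq_self (fun x => (ι ⁻¹' B).indicator (fun x => ‖x - p‖ ^ m) x) p)

end Congruence

section Continuity

variable {E H : Type*} [NormedAddCommGroup E] [InnerProductSpace ℝ E] {B : Set E}
  [NormedAddCommGroup H] [InnerProductSpace ℝ H] {ι : H →ₗᵢ[ℝ] E} {u₀ : E}
  [FiniteDimensional ℝ H] [MeasurableSpace H] [BorelSpace H]

lemma ae_gauge_linearIsometry_ne_one (hBc : IsCompact B) (hBv : Convex ℝ B)
    (hB0 : 0 ∈ interior B) (T : H →ₗᵢ[ℝ] E) : ∀ᵐ y : H, gauge B (T y) ≠ 1 := by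
  have hS : Convex ℝ (T ⁻¹' B) := hBv.linear_preimage T.toLinearMap
  have h0 := measure_eq_zero_iff_ae_notMem.1 (Convex.addHaar_frontier (volume : Measure H) hS)
  filter_upwards [h0] with y hy h1
  have hyB : y ∈ T ⁻¹' B := (gauge_le_one_iff_mem hBc hBv hB0).1 h1.le
  refine hy ⟨subset_closure hyB, fun hyi => ?_⟩
  have hev : ∀ᶠ t : ℝ in 𝓝 1, t • y ∈ T ⁻¹' B := by
    have h2 : Tendsto (fun t : ℝ => t • y) (𝓝 1) (𝓝 ((1 : ℝ) • y)) := tendsto_id.smul_const _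
    rw [one_smul] at h2
    exact h2.eventually (mem_interior_iff_mem_nhds.1 hyi)
  obtain ⟨t, htB, ht⟩ := ((hev.filter_mono nhdsWithin_le_nhds).and
    (self_mem_nhdsWithin (s := Set.Ioi (1 : ℝ)))).exists
  have ht' : (1 : ℝ) < t := ht
  have h3 : gauge B (t • T y) ≤ 1 := by
    rw [gauge_le_one_iff_mem hBc hBv hB0, ← map_smul]
    exact htB
  rw [gauge_smul_of_nonneg (by linarith), h1, smul_eq_mul, mul_one] at h3
  linarith

variable [MeasurableSpace E] [BorelSpace E]

/-- If the `m`-th moments of the central sections take only countably many values, they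
are all equal, by continuity and connectedness of the sphere. -/
lemma section_integral_eq_of_countable (hE : 1 < Module.rank ℝ E)
    (hBc : IsCompact B) (hBv : Convex ℝ B) (hB0 : 0 ∈ interior B)
    (hu₀ : ‖u₀‖ = 1) (hι : ∀ x, (∃ y, ι y = x) ↔ ⟪u₀, x⟫ = 0) (m : ℕ)
    (hcount : (Set.range fun g : E ≃ₗᵢ[ℝ] E =>
      ∫ y, B.indicator (fun x => ‖x‖ ^ m) (g (ι y))).Countable) (g g' : E ≃ₗᵢ[ℝ] E) :
    ∫ y, B.indicator (fun x => ‖x‖ ^ m) (g (ι y)) =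
      ∫ y, B.indicator (fun x => ‖x‖ ^ m) (g' (ι y)) := by
  set F := B.indicator fun x => ‖x‖ ^ m with hF
  set I : (E ≃ₗᵢ[ℝ] E) → ℝ := fun g => ∫ y, F (g (ι y)) with hI
  obtain ⟨R, hR⟩ := hBc.isBounded.subset_closedBall 0
  have hFm : Measurable F :=
    (by fun_prop : Measurable fun x : E => ‖x‖ ^ m).indicator hBc.measurableSet
  have hwd : ∀ (g g' : E ≃ₗᵢ[ℝ] E) (c : ℝ), g' u₀ = c • g u₀ → I g' = I g := by
    intro g g' c h
    obtain ⟨k, hk⟩ := exists_restrict_linearIsometryEquiv hι (g.trans g'.symm) (fun y => by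
      have h1 : ⟪u₀, ι y⟫ = 0 := (hι _).1 ⟨y, rfl⟩
      rw [← g'.inner_map_map, h]
      simp [inner_smul_left, h1])
    have hk' : ∀ y, g (ι y) = g' (ι (k y)) := fun y => by rw [← hk]; simp
    simp only [hI, hk']
    exact (k.measurePreserving.integral_comp' (f := k.toHomeomorph.toMeasurableEquiv)
      (fun y => F (g' (ι y)))).symm
  have hex : ∀ ξ : E, ∃ g : E ≃ₗᵢ[ℝ] E, ‖ξ‖ = 1 → g u₀ = ξ := by
    intro ξ
    by_cases h : ‖ξ‖ = 1
    · obtain ⟨g, hg⟩ := exists_linearIsometryEquiv_apply_eq (hu₀.trans h.symm)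
      exact ⟨g, fun _ => hg⟩
    · exact ⟨.refl _ _, fun h' => absurd h' h⟩
  choose G hG using hex
  have hcont : ContinuousOn (fun ξ => I (G ξ)) (sphere 0 1) := by
    intro ξ₀ hξ₀
    have hξ₀' : ‖ξ₀‖ = 1 := by simpa using hξ₀
    let T : E → E ≃ₗᵢ[ℝ] E := fun ξ => (ℝ ∙ (ξ₀ - (-ξ)))ᗮ.reflection
    have hTt : ∀ x, ⟪ξ₀, x⟫ = 0 → Tendsto (fun ξ => T ξ x) (𝓝 ξ₀) (𝓝 x) := by
      intro x hx
      have hT : ∀ ξ, T ξ x = x - (2 * (⟪ξ₀ + ξ, x⟫ / ‖ξ₀ + ξ‖ ^ 2)) • (ξ₀ + ξ) := by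
        intro ξ
        simp only [T, Submodule.reflection_orthogonal_apply, Submodule.reflection_singleton_apply,
          sub_neg_eq_add]
        rw [neg_sub, two_mul, add_smul, two_smul]
        rfl
      simp_rw [hT]
      have hne : ‖ξ₀ + ξ₀‖ ^ 2 ≠ 0 := by
        rw [← two_smul ℝ, norm_smul, hξ₀']; norm_num
      have h2 : ContinuousAt (fun ξ => x - (2 * (⟪ξ₀ + ξ, x⟫ / ‖ξ₀ + ξ‖ ^ 2)) • (ξ₀ + ξ)) ξ₀ := by
        fun_prop (disch := exact hne)
      have h3 := h2.tendsto
      simpa [inner_add_left, hx] using h3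
    have hlim : Tendsto (fun ξ => I ((G ξ₀).trans (T ξ))) (𝓝 ξ₀) (𝓝 (I (G ξ₀))) := by
      refine tendsto_integral_filter_of_dominated_convergence
        ((closedBall (0 : H) R).indicator fun _ => R ^ m) (.of_forall fun ξ => ?_)
        (.of_forall fun ξ => .of_forall fun z => ?_) ?_ ?_
      · exact (hFm.comp (((G ξ₀).trans (T ξ)).continuous.comp
          ι.continuous).measurable).aestronglyMeasurable
      · by_cases hz : ((G ξ₀).trans (T ξ)) (ι z) ∈ B
        · have hzR := hR hz
          rw [mem_closedBall_zero_iff, LinearIsometryEquiv.norm_map, ι.norm_map] at hzR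
          rw [hF, Set.indicator_of_mem hz, Set.indicator_of_mem (by simpa using hzR),
            LinearIsometryEquiv.norm_map, ι.norm_map, norm_pow, norm_norm]
          gcongr
        · rw [hF, Set.indicator_of_notMem hz, norm_zero]
          refine Set.indicator_nonneg (fun x hx => ?_) _
          have : 0 ≤ R := (norm_nonneg x).trans (by simpa using hx)
          positivity
      · rw [integrable_indicator_iff measurableSet_closedBall]
        exact integrableOn_const (isCompact_closedBall _ _).measure_lt_top.ne
      · filter_upwards [ae_gauge_linearIsometry_ne_one hBc hBv hB0
          ((G ξ₀).toLinearIsometry.comp ι)] with y hy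
        have h1 := continuousAt_indicator_norm_pow hBc hBv hB0 m hy
        refine h1.tendsto.comp (hTt _ ?_)
        have h2 : ⟪u₀, ι y⟫ = 0 := (hι _).1 ⟨y, rfl⟩
        have h3 := hG ξ₀ hξ₀'
        have h4 := (G ξ₀).inner_map_map u₀ (ι y)
        rw [h3, h2] at h4
        exact h4
    refine (hlim.mono_left nhdsWithin_le_nhds).congr' ?_
    filter_upwards [self_mem_nhdsWithin] with ξ hξ
    have hξ' : ‖ξ‖ = 1 := by simpa using hξ
    refine hwd _ _ (-1) ?_
    rw [hG ξ hξ', LinearIsometryEquiv.trans_apply, hG ξ₀ hξ₀', neg_one_smul]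
    exact Submodule.reflection_sub (by rw [norm_neg, hξ', hξ₀'])
  have hpre := (isPreconnected_sphere hE 0 1).image _ hcont
  have hsub := hcount.isTotallyDisconnected _ (by rintro _ ⟨ξ, -, rfl⟩; exact ⟨_, rfl⟩) hpre
  have hg1 : ∀ g : E ≃ₗᵢ[ℝ] E, I g = I (G (g u₀)) := fun g =>
    hwd _ _ 1 (by rw [hG _ (by rw [g.norm_map, hu₀]), one_smul])
  have hmem : ∀ g : E ≃ₗᵢ[ℝ] E, I g ∈ (fun ξ => I (G ξ)) '' sphere 0 1 := fun g =>
    ⟨g u₀, by simp [hu₀], (hg1 g).symm⟩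
  exact hsub (hmem g) (hmem g')

end Continuity

section PowerSums

lemma pow_add_sub_pow_lt {x y d : ℝ} (hx : 0 ≤ x) (hxy : x < y) (hd : 0 < d) {n : ℕ} (hn : 2 ≤ n) :
    (x + d) ^ n - x ^ n < (y + d) ^ n - y ^ n := by
  induction n, hn using Nat.le_induction with
  | base => nlinarith
  | succ n hn ih =>
    have h1 : (x + d) ^ n ≤ (y + d) ^ n := by gcongr
    have h2 : 0 ≤ (x + d) ^ n - x ^ n := sub_nonneg.2 (by gcongr; linarith)
    have h3 : x * ((x + d) ^ n - x ^ n) ≤ y * ((x + d) ^ n - x ^ n) := by gcongr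
    have h4 : y * ((x + d) ^ n - x ^ n) < y * ((y + d) ^ n - y ^ n) :=
      mul_lt_mul_of_pos_left ih (hx.trans_lt hxy)
    have h5 : d * (x + d) ^ n ≤ d * (y + d) ^ n := by gcongr
    rw [pow_succ, pow_succ, pow_succ, pow_succ]
    linarith

lemma pow_add_mul_pow_mul_sub_le {x y : ℝ} (hx : 0 ≤ x) (hy : 0 ≤ y) (n : ℕ) :
    y ^ (n + 1) + (n + 1) * y ^ n * (x - y) ≤ x ^ (n + 1) := by
  induction n with
  | zero => simp
  | succ n ih =>
    have h1 := mul_le_mul_of_nonneg_left ih hx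
    have h2 : 0 ≤ (n + 1) * y ^ n * (x - y) ^ 2 := by positivity
    push_cast
    calc _ = x * (y ^ (n + 1) + (n + 1) * y ^ n * (x - y)) - (n + 1) * y ^ n * (x - y) ^ 2 := by
            ring
      _ ≤ x * x ^ (n + 1) := by linarith
      _ = _ := by ring

lemma eq_of_pow_add_pow_eq {a b d : ℝ} (hb : 0 ≤ b) (had : 0 ≤ a - d) (hd : 0 < d) {n : ℕ}
    (hn : 2 ≤ n) (h : a ^ n + b ^ n = (a - d) ^ n + (b + d) ^ n) : a - d = b := by
  rcases lt_trichotomy (a - d) b with h1 | h1 | h1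
  · have := pow_add_sub_pow_lt had h1 hd hn
    rw [sub_add_cancel] at this
    linarith
  · exact h1
  · have := pow_add_sub_pow_lt hb h1 hd hn
    rw [sub_add_cancel] at this
    linarith

/-- On the level sets of `a ^ n + b ^ n` away from the diagonal, `a - b` is a Lipschitz function
of `a + b`. -/
lemma sub_sub_sub_le_of_pow_add_pow_eq {a b a' b' R δ : ℝ} (ha' : 0 < a') (hb : 0 ≤ b)
    (hb' : 0 ≤ b') (hR : a' ≤ R) (hδ : 0 < δ) (hab : b' + δ ≤ a') (haa : a' ≤ a) (hbb : b ≤ b')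
    {n : ℕ} (hn : 2 ≤ n) (h : a ^ n + b ^ n = a' ^ n + b' ^ n) :
    (a - b) - (a' - b') ≤ 2 * R / δ * ((a' + b') - (a + b)) := by
  obtain ⟨k, rfl⟩ : ∃ k, n = k + 1 + 1 := ⟨n - 2, by omega⟩
  have h1 := pow_add_mul_pow_mul_sub_le (ha'.le.trans haa) ha'.le (k + 1)
  have h2 := pow_add_mul_pow_mul_sub_le hb hb' (k + 1)
  have h3 : a' ^ (k + 1) * (a - a') ≤ b' ^ (k + 1) * (b' - b) := by
    have hk : (0 : ℝ) < (k + 1 : ℕ) + 1 := by positivity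
    refine le_of_mul_le_mul_left ?_ hk
    linarith
  have h4 : b' ^ k ≤ a' ^ k := by gcongr; linarith
  have h5 : b' ^ (k + 1) * (b' - b) ≤ a' ^ k * (b' * (b' - b)) := by
    rw [pow_succ, mul_assoc]
    exact mul_le_mul_of_nonneg_right h4 (mul_nonneg hb' (sub_nonneg.2 hbb))
  have h6 : a' * (a - a') ≤ b' * (b' - b) := by
    refine le_of_mul_le_mul_left ?_ (pow_pos ha' k)
    calc a' ^ k * (a' * (a - a')) = a' ^ (k + 1) * (a - a') := by ring
      _ ≤ _ := h3.trans h5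
  have h7 : δ * (b' - b) ≤ a' * ((b' - b) - (a - a')) := by nlinarith
  have h8 : 0 ≤ (b' - b) - (a - a') := by
    by_contra hneg
    push Not at hneg
    have : a' * ((b' - b) - (a - a')) < 0 := mul_neg_of_pos_of_neg ha' hneg
    nlinarith
  have h9 : δ * (b' - b) ≤ R * ((b' - b) - (a - a')) := h7.trans (by gcongr)
  rw [div_mul_eq_mul_div, le_div_iff₀ hδ]
  nlinarith

lemma abs_sub_sub_sub_le_of_pow_add_pow_eq {a b a' b' R δ : ℝ} (ha : 0 < a) (ha' : 0 < a')
    (hb : 0 ≤ b) (hb' : 0 ≤ b') (hR : a ≤ R) (hR' : a' ≤ R) (hδ : 0 < δ) (hab : b + δ ≤ a)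
    (hab' : b' + δ ≤ a') {n : ℕ} (hn : 2 ≤ n) (h : a ^ n + b ^ n = a' ^ n + b' ^ n) :
    |(a - b) - (a' - b')| ≤ 2 * R / δ * |(a + b) - (a' + b')| := by
  wlog haa : a' ≤ a generalizing a b a' b'
  · rw [abs_sub_comm, abs_sub_comm (a + b)]
    exact this ha' ha hb' hb hR' hR hab' hab h.symm (not_le.1 haa).le
  have hbb : b ≤ b' := by
    have : a' ^ n ≤ a ^ n := by gcongr
    exact le_of_pow_le_pow_left₀ (show n ≠ 0 by omega) hb' (by linarith)
  have h1 := sub_sub_sub_le_of_pow_add_pow_eq ha' hb hb' hR' hδ hab' haa hbb hn h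
  rw [abs_of_nonneg (by linarith)]
  refine h1.trans ?_
  rw [abs_sub_comm]
  have : 0 ≤ 2 * R / δ := by have := ha.le.trans hR; positivity
  gcongr
  exact le_abs_self _

end PowerSums

section DoubleNormal

variable {H : Type*} [NormedAddCommGroup H] [InnerProductSpace ℝ H] {K : Set H}

lemma exists_support_functional (hK : Convex ℝ K) {p v : H} (hp : p ∈ interior K) {a : ℝ}
    (ha : 0 < a) (hv : ∀ s, a < s → p + s • v ∉ K) :
    ∃ l : StrongDual ℝ H, l v = 1 ∧ ∀ x ∈ K, l (x - p) ≤ a := by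
  have hnot : p + a • v ∉ interior K := by
    intro h
    have h1 : Tendsto (fun s : ℝ => p + s • v) (𝓝 a) (𝓝 (p + a • v)) :=
      (tendsto_id.smul_const _).const_add _
    have h2 := h1.eventually (mem_interior_iff_mem_nhds.1 h)
    obtain ⟨s, hs, hs'⟩ := ((h2.filter_mono nhdsWithin_le_nhds).and
      (self_mem_nhdsWithin (s := Set.Ioi a))).exists
    exact hv s hs' hs
  obtain ⟨f, hf⟩ := geometric_hahn_banach_open_point hK.interior isOpen_interior hnot
  have hle : ∀ x ∈ K, f x ≤ f (p + a • v) := by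
    intro x hx
    have h1 : x ∈ closure (interior K) := by
      rw [hK.closure_interior_eq_closure_of_nonempty_interior ⟨p, hp⟩]
      exact subset_closure hx
    exact closure_minimal (fun y hy => (hf y hy).le)
      (isClosed_le f.continuous continuous_const) h1
  have hpos : 0 < f v := by
    have := hf p hp
    rw [map_add, map_smul, smul_eq_mul] at this
    exact pos_of_mul_pos_right (by linarith) ha.le
  refine ⟨(f v)⁻¹ • f, by simp [hpos.ne'], fun x hx => ?_⟩
  have := hle x hx
  rw [map_add, map_smul, smul_eq_mul] at this
  change (f v)⁻¹ * f (x - p) ≤ a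
  rw [inv_mul_le_iff₀ hpos, map_sub]
  linarith

/-- First variation of the power sum of a chord through `p` of constant power sum. -/
lemma pow_mul_add_pow_mul_eq_zero {p v t : H} {n : ℕ} {a b c : ℝ} (hv : ‖v‖ = 1)
    (habc : a ^ n + b ^ n = c) (hn : n ≠ 0)
    (hp : ∀ u : H, ‖u‖ = 1 → ∃ a b : ℝ, 0 ≤ a ∧ 0 ≤ b ∧ p + a • u ∈ K ∧ p - b • u ∈ K ∧
      a ^ n + b ^ n = c)
    {l l' : StrongDual ℝ H} (hl : l v = 1) (hl' : l' v = 1) (hla : ∀ x ∈ K, l (x - p) ≤ a)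
    (hlb : ∀ x ∈ K, -b ≤ l' (x - p)) (ht : ⟪v, t⟫ = 0) : a ^ n * l t + b ^ n * l' t = 0 := by
  let φ : ℝ → ℝ := fun s => √(1 + s ^ 2 * ‖t‖ ^ 2) ^ n *
    (a ^ n * ((1 + s * l t) ^ n)⁻¹ + b ^ n * ((1 + s * l' t) ^ n)⁻¹)
  have hd1 : HasDerivAt (fun s : ℝ => √(1 + s ^ 2 * ‖t‖ ^ 2) ^ n) 0 0 := by
    have h1 : HasDerivAt (fun s : ℝ => 1 + s ^ 2 * ‖t‖ ^ 2) 0 0 := by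
      simpa using (((hasDerivAt_id (0 : ℝ)).pow 2).mul_const (‖t‖ ^ 2)).const_add 1
    simpa using (h1.sqrt (by simp)).fun_pow n
  have hd2 : ∀ β : ℝ, HasDerivAt (fun s : ℝ => ((1 + s * β) ^ n)⁻¹) (-(n * β)) 0 := by
    intro β
    have h1 : HasDerivAt (fun s : ℝ => (1 + s * β)) β 0 := by
      simpa using ((hasDerivAt_id (0 : ℝ)).mul_const β).const_add 1
    simpa using (h1.fun_pow n).fun_inv (by simp)
  have hφ : HasDerivAt φ (-(n * (a ^ n * l t + b ^ n * l' t))) 0 := by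
    have := hd1.mul (((hd2 (l t)).const_mul (a ^ n)).add ((hd2 (l' t)).const_mul (b ^ n)))
    refine this.congr_deriv ?_
    simp
    ring
  have hpos : ∀ β : ℝ, ∀ᶠ s : ℝ in 𝓝 0, 0 < 1 + s * β := by
    intro β
    have h1 : Tendsto (fun s : ℝ => 1 + s * β) (𝓝 0) (𝓝 (1 + 0 * β)) :=
      (tendsto_id.mul_const _).const_add _
    exact h1.eventually (lt_mem_nhds (by simp))
  have hmin : IsLocalMin φ 0 := by
    filter_upwards [hpos (l t), hpos (l' t)] with s h1 h2
    have hN : ‖v + s • t‖ = √(1 + s ^ 2 * ‖t‖ ^ 2) := by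
      rw [← Real.sqrt_sq (norm_nonneg _), norm_add_sq_real, inner_smul_right, ht, hv, norm_smul,
        mul_pow, Real.norm_eq_abs, sq_abs]
      norm_num
    have hNpos : 0 < √(1 + s ^ 2 * ‖t‖ ^ 2) := Real.sqrt_pos.2 (by positivity)
    set N := √(1 + s ^ 2 * ‖t‖ ^ 2) with hNdef
    obtain ⟨a', b', ha', hb', hpa, hpb, hc⟩ := hp (N⁻¹ • (v + s • t)) (by
      rw [norm_smul, hN, Real.norm_of_nonneg (inv_nonneg.2 hNpos.le), inv_mul_cancel₀ hNpos.ne'])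
    have h3 := hla _ hpa
    have h4 := hlb _ hpb
    rw [add_sub_cancel_left, map_smul, map_smul, map_add, map_smul, hl, smul_eq_mul, smul_eq_mul,
      smul_eq_mul] at h3
    rw [sub_sub_cancel_left, map_neg, map_smul, map_smul, map_add, map_smul, hl', smul_eq_mul,
      smul_eq_mul, smul_eq_mul] at h4
    have h5 : a' ≤ N * (a * (1 + s * l t)⁻¹) := by
      rw [← mul_assoc, ← div_eq_mul_inv, le_div_iff₀ h1, ← inv_mul_le_iff₀ hNpos]
      linarith
    have h6 : b' ≤ N * (b * (1 + s * l' t)⁻¹) := by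
      rw [← mul_assoc, ← div_eq_mul_inv, le_div_iff₀ h2, ← inv_mul_le_iff₀ hNpos]
      linarith
    have h7 : a' ^ n ≤ N ^ n * (a ^ n * ((1 + s * l t) ^ n)⁻¹) := by
      rw [← inv_pow, ← mul_pow, ← mul_pow]; gcongr
    have h8 : b' ^ n ≤ N ^ n * (b ^ n * ((1 + s * l' t) ^ n)⁻¹) := by
      rw [← inv_pow, ← mul_pow, ← mul_pow]; gcongr
    have h9 : φ 0 = c := by simp [φ, habc]
    rw [h9, ← hc]
    simp only [φ]
    rw [mul_add]
    exact add_le_add h7 h8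
  have h0 := hmin.hasDerivAt_eq_zero hφ
  have hn' : (n : ℝ) ≠ 0 := by exact_mod_cast hn
  simpa [hn'] using h0

end DoubleNormal

section Centers

variable {H : Type*} [NormedAddCommGroup H] [InnerProductSpace ℝ H] {K : Set H}

/-- `p` is an interior point of `K` dividing every chord of `K` through it into two parts,
of length at most `R`, whose `n`-th powers sum to `c`. -/
def IsPowerCenter (K : Set H) (n : ℕ) (R c : ℝ) (p : H) : Prop :=
  p ∈ interior K ∧ ∀ v : H, ‖v‖ = 1 → ∃ a b : ℝ, 0 < a ∧ a ≤ R ∧ 0 < b ∧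
    (∀ s : ℝ, p + s • v ∈ K ↔ -b ≤ s ∧ s ≤ a) ∧ a ^ n + b ^ n = c

lemma IsPowerCenter.exists_chord {n : ℕ} {R c : ℝ} {p : H} (hp : IsPowerCenter K n R c p) (u : H)
    (hu : ‖u‖ = 1) : ∃ a b : ℝ, 0 ≤ a ∧ 0 ≤ b ∧ p + a • u ∈ K ∧ p - b • u ∈ K ∧
      a ^ n + b ^ n = c := by
  obtain ⟨a, b, ha, -, hb, h, hc⟩ := hp.2 u hu
  refine ⟨a, b, ha.le, hb.le, (h a).2 ⟨by linarith, le_rfl⟩, ?_, hc⟩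
  rw [sub_eq_add_neg, ← neg_smul]
  exact (h (-b)).2 ⟨le_rfl, by linarith⟩

/-- The chord through two distinct power centers is a double normal. -/
lemma exists_double_normal (hK : Convex ℝ K) {n : ℕ} (hn : 2 ≤ n) {R c : ℝ} {p q v : H}
    (hp : IsPowerCenter K n R c p) (hq : IsPowerCenter K n R c q) {d : ℝ} (hd : 0 < d)
    (hv : ‖v‖ = 1) (hpq : q = p + d • v) :
    ∃ a b : ℝ, 0 < b ∧ a ≤ R ∧ a - b = d ∧ a ^ n + b ^ n = c ∧ p + a • v ∈ K ∧ p - b • v ∈ K ∧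
      ∀ x ∈ K, -b ≤ ⟪v, x - p⟫ ∧ ⟪v, x - p⟫ ≤ a := by
  obtain ⟨a, b, ha, haR, hb, h, hc⟩ := hp.2 v hv
  obtain ⟨a', b', ha', -, hb', h', hc'⟩ := hq.2 v hv
  have hqs : ∀ s : ℝ, q + s • v = p + (d + s) • v := fun s => by rw [hpq, add_smul, add_assoc]
  have hiff : ∀ s, (-b' ≤ s ∧ s ≤ a') ↔ (-b ≤ d + s ∧ d + s ≤ a) := fun s => by
    rw [← h', hqs, h]
  have e1 := (hiff a').1 ⟨by linarith, le_rfl⟩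
  have e2 := (hiff (-b')).1 ⟨le_rfl, by linarith⟩
  have e3 := (hiff (a - d)).2 ⟨by linarith, by linarith⟩
  have e4 := (hiff (-b - d)).2 ⟨by linarith, by linarith⟩
  have ea : a' = a - d := by linarith
  have eb : b' = b + d := by linarith
  subst ea eb
  have hab := eq_of_pow_add_pow_eq hb.le ha'.le hd hn (hc.trans hc'.symm)
  have hpa : p + a • v ∈ K := (h a).2 ⟨by linarith, le_rfl⟩
  have hpb : p - b • v ∈ K := by
    rw [sub_eq_add_neg, ← neg_smul]
    exact (h (-b)).2 ⟨le_rfl, by linarith⟩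
  obtain ⟨l, hl, hla⟩ := exists_support_functional hK hp.1 ha (fun s hs hmem => by
    linarith [((h s).1 hmem).2])
  obtain ⟨l₁, hl₁, hlb₁⟩ := exists_support_functional hK (v := -v) hp.1 hb (fun s hs hmem => by
    rw [smul_neg, ← neg_smul] at hmem
    linarith [((h _).1 hmem).1])
  obtain ⟨l', rfl⟩ : ∃ l', l₁ = -l' := ⟨-l₁, by simp⟩
  have hl' : l' v = 1 := by simpa using hl₁
  have hlb : ∀ x ∈ K, -b ≤ l' (x - p) := fun x hx => by
    have h1 : -(l' (x - p)) ≤ b := hlb₁ x hx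
    linarith
  have hzero : ∀ t, ⟪v, t⟫ = 0 → l t = 0 ∧ l' t = 0 := by
    intro t ht
    have h1 := pow_mul_add_pow_mul_eq_zero hv hc (by omega) hp.exists_chord hl hl' hla hlb ht
    have h2 := pow_mul_add_pow_mul_eq_zero (K := K) (p := q) (a := b) (b := a) (c := c) hv
      (by rw [add_comm]; exact hc) (by omega) hq.exists_chord hl hl'
      (fun x hx => by
        rw [hpq, ← sub_sub, map_sub, map_smul, hl, smul_eq_mul]
        linarith [hla x hx])
      (fun x hx => by
        rw [hpq, ← sub_sub, map_sub, map_smul, hl', smul_eq_mul]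
        linarith [hlb x hx]) ht
    have hlt : b ^ n < a ^ n := pow_lt_pow_left₀ (by linarith) hb.le (by omega)
    have hbn : 0 < b ^ n := pow_pos hb n
    have hne : (a ^ n) ^ 2 - (b ^ n) ^ 2 ≠ 0 := by nlinarith
    constructor
    · refine (mul_eq_zero.1 (show ((a ^ n) ^ 2 - (b ^ n) ^ 2) * l t = 0 from ?_)).resolve_left hne
      linear_combination a ^ n * h1 - b ^ n * h2
    · refine (mul_eq_zero.1 (show ((a ^ n) ^ 2 - (b ^ n) ^ 2) * l' t = 0 from ?_)).resolve_left hne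
      linear_combination a ^ n * h2 - b ^ n * h1
  have hinner : ∀ x, l x = ⟪v, x⟫ ∧ l' x = ⟪v, x⟫ := by
    intro x
    have h1 := hzero (x - ⟪v, x⟫ • v) (by
      rw [inner_sub_right, inner_smul_right, real_inner_self_eq_norm_sq, hv]; ring)
    rw [map_sub, map_sub, map_smul, map_smul, hl, hl', smul_eq_mul, mul_one] at h1
    exact ⟨sub_eq_zero.1 h1.1, sub_eq_zero.1 h1.2⟩
  refine ⟨a, b, hb, haR, by linarith, hc, hpa, hpb, fun x hx => ⟨?_, ?_⟩⟩
  · rw [← (hinner _).2]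
    exact hlb x hx
  · rw [← (hinner _).1]
    exact hla x hx

lemma abs_norm_sub_sq_sub_le (hK : Convex ℝ K) {n : ℕ} (hn : 2 ≤ n) {R c : ℝ} {q r r' : H}
    (hq : IsPowerCenter K n R c q) (hr : IsPowerCenter K n R c r)
    (hr' : IsPowerCenter K n R c r') {δ : ℝ} (hδ : 0 < δ) (h : δ ≤ ‖r - q‖) (h' : δ ≤ ‖r' - q‖) :
    |‖r - q‖ ^ 2 - ‖r' - q‖ ^ 2| ≤ 2 * R * (2 * R / δ * (R / δ ^ 2)) * ‖r - r'‖ ^ 2 := by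
  have hdir : ∀ x : H, δ ≤ ‖x - q‖ → ‖‖x - q‖⁻¹ • (x - q)‖ = 1 ∧
      x = q + ‖x - q‖ • (‖x - q‖⁻¹ • (x - q)) := fun x hx => by
    have hne : ‖x - q‖ ≠ 0 := by linarith
    rw [norm_smul, norm_inv, norm_norm, inv_mul_cancel₀ hne, smul_smul, mul_inv_cancel₀ hne]
    simp
  obtain ⟨hv, hrv⟩ := hdir r h
  obtain ⟨hv', hrv'⟩ := hdir r' h'
  set d := ‖r - q‖ with hd
  set d' := ‖r' - q‖ with hd'
  have hd0 : 0 < d := hδ.trans_le h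
  have hd0' : 0 < d' := hδ.trans_le h'
  set v := d⁻¹ • (r - q) with hvdef
  set v' := d'⁻¹ • (r' - q) with hvdef'
  obtain ⟨a, b, hb, haR, hab, hc, hpa, hpb, hx⟩ := exists_double_normal hK hn hq hr hd0 hv hrv
  obtain ⟨a', b', hb', haR', hab', hc', hpa', hpb', hx'⟩ :=
    exists_double_normal hK hn hq hr' hd0' hv' hrv'
  have hR : 0 < R := by linarith
  have hin : 1 - ⟪v, v'⟫ ≤ ‖r - r'‖ ^ 2 / (2 * δ ^ 2) := by
    have h1 : ‖r - r'‖ ^ 2 = d ^ 2 - 2 * (d * d' * ⟪v, v'⟫) + d' ^ 2 := by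
      rw [show r - r' = (r - q) - (r' - q) by abel, norm_sub_sq_real, hvdef, hvdef',
        inner_smul_left, inner_smul_right, ← hd, ← hd']
      simp only [conj_trivial]
      field_simp
    have h2 : ⟪v, v'⟫ ≤ 1 := by
      have := real_inner_le_norm v v'
      rwa [hv, hv', one_mul] at this
    rw [le_div_iff₀ (by positivity), h1]
    have h3 : δ ^ 2 ≤ d * d' := by nlinarith
    have h4 : (1 - ⟪v, v'⟫) * δ ^ 2 ≤ (1 - ⟪v, v'⟫) * (d * d') :=
      mul_le_mul_of_nonneg_left h3 (by linarith)
    nlinarith [sq_nonneg (d - d')]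
  have hL : |(a + b) - (a' + b')| ≤ R / δ ^ 2 * ‖r - r'‖ ^ 2 := by
    have i1 := (hx _ hpa').2
    have i2 := (hx _ hpb').1
    have i3 := (hx' _ hpa).2
    have i4 := (hx' _ hpb).1
    rw [add_sub_cancel_left, inner_smul_right] at i1 i3
    rw [sub_sub_cancel_left, inner_neg_right, inner_smul_right] at i2 i4
    rw [real_inner_comm v v'] at i3 i4
    have e : R / δ ^ 2 * ‖r - r'‖ ^ 2 = (2 * R) * (‖r - r'‖ ^ 2 / (2 * δ ^ 2)) := by
      field_simp
    have h0 : 0 ≤ ‖r - r'‖ ^ 2 / (2 * δ ^ 2) := by positivity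
    rw [e, abs_le]
    constructor
    · have : (a' + b') * (1 - ⟪v, v'⟫) ≤ (a' + b') * (‖r - r'‖ ^ 2 / (2 * δ ^ 2)) :=
        mul_le_mul_of_nonneg_left hin (by linarith)
      have : (a' + b') * (‖r - r'‖ ^ 2 / (2 * δ ^ 2)) ≤ 2 * R * (‖r - r'‖ ^ 2 / (2 * δ ^ 2)) :=
        mul_le_mul_of_nonneg_right (by linarith) h0
      linarith
    · have : (a + b) * (1 - ⟪v, v'⟫) ≤ (a + b) * (‖r - r'‖ ^ 2 / (2 * δ ^ 2)) :=
        mul_le_mul_of_nonneg_left hin (by linarith)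
      have : (a + b) * (‖r - r'‖ ^ 2 / (2 * δ ^ 2)) ≤ 2 * R * (‖r - r'‖ ^ 2 / (2 * δ ^ 2)) :=
        mul_le_mul_of_nonneg_right (by linarith) h0
      linarith
  have hdd := abs_sub_sub_sub_le_of_pow_add_pow_eq (by linarith) (by linarith) hb.le hb'.le haR haR'
    hδ (by linarith) (by linarith) hn (hc.trans hc'.symm)
  rw [hab, hab'] at hdd
  calc |d ^ 2 - d' ^ 2| = (d + d') * |d - d'| := by
        rw [← abs_of_pos (show 0 < d + d' by linarith), ← abs_mul]
        congr 1
        ring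
    _ ≤ 2 * R * (2 * R / δ * (R / δ ^ 2 * ‖r - r'‖ ^ 2)) := by
        have := hdd.trans (mul_le_mul_of_nonneg_left hL (by positivity))
        exact mul_le_mul (by linarith) this (abs_nonneg _) (by positivity)
    _ = _ := by ring

end Centers

section Countable

variable {H : Type*} [NormedAddCommGroup H] [InnerProductSpace ℝ H] [FiniteDimensional ℝ H]
  {K : Set H}

/-- If all inner products of `z.1 - z.2` with differences of points of `W` are quadratically
small near `p`, then `p` is not an accumulation point of `W`. -/
lemma nhdsWithin_eq_bot_of_inner_isBigO {W : Set H} {p : H} (hpW : p ∉ W)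
    (h : ∀ q ∈ W, ∀ q' ∈ W, (fun z : H × H => ⟪q - q', z.1 - z.2⟫) =O[𝓝[W] p ×ˢ 𝓝[W] p]
      fun z => ‖z.1 - z.2‖ ^ 2) : 𝓝[W] p = ⊥ := by
  by_contra hbot
  have : (𝓝[W] p).NeBot := ⟨hbot⟩
  set f := 𝓝[W] p ×ˢ 𝓝[W] p with hf
  let U : Submodule ℝ H :=
    { carrier := {w | (fun z : H × H => ⟪w, z.1 - z.2⟫) =O[f] fun z => ‖z.1 - z.2‖ ^ 2}
      add_mem' := fun {x y} hx hy => by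
        have h1 := IsBigO.add hx hy
        simpa only [Set.mem_ofPred_eq, inner_add_left] using h1
      zero_mem' := by
        simpa only [Set.mem_ofPred_eq, inner_zero_left] using isBigO_zero _ _
      smul_mem' := fun k x hx => by
        have h1 := IsBigO.const_mul_left hx k
        simpa only [Set.mem_ofPred_eq, inner_smul_left, conj_trivial] using h1 }
  have hUW : ∀ q ∈ W, ∀ q' ∈ W, q - q' ∈ U := h
  have hev : ∀ᶠ z in f, z.1 ∈ W ∧ z.2 ∈ W :=
    (eventually_mem_nhdsWithin (a := p) (s := W)).prod_mk
      (eventually_mem_nhdsWithin (a := p) (s := W))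
  have hbig : (fun z : H × H => z.1 - z.2) =O[f] fun z => ‖z.1 - z.2‖ ^ 2 := by
    let b := stdOrthonormalBasis ℝ U
    have h1 : (fun z : H × H => ∑ i, ⟪(b i : H), z.1 - z.2⟫ • (b i : H)) =O[f]
        fun z => ‖z.1 - z.2‖ ^ 2 := by
      refine IsBigO.fun_sum (A := fun i (z : H × H) => ⟪(b i : H), z.1 - z.2⟫ • (b i : H))
        fun i _ => ?_
      have h2 : (fun z : H × H => ⟪(b i : H), z.1 - z.2⟫) =O[f] fun z => ‖z.1 - z.2‖ ^ 2 :=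
        (b i).2
      have h3 : (fun z : H × H => ⟪(b i : H), z.1 - z.2⟫ • (b i : H)) =O[f]
          fun z : H × H => ⟪(b i : H), z.1 - z.2⟫ :=
        IsBigO.of_bound ‖(b i : H)‖ (.of_forall fun z => by rw [norm_smul, mul_comm])
      exact h3.trans h2
    refine h1.congr' ?_ .rfl
    filter_upwards [hev] with z hz
    have h3 := b.sum_repr' ⟨z.1 - z.2, hUW _ hz.1 _ hz.2⟩
    have h4 := congrArg (Subtype.val) h3
    simpa using h4
  obtain ⟨C, hC⟩ := hbig.bound
  have hlim : Tendsto (fun z : H × H => C * ‖z.1 - z.2‖) f (𝓝 0) := by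
    have h1 : Tendsto (fun z : H × H => C * ‖z.1 - z.2‖) (𝓝 p ×ˢ 𝓝 p) (𝓝 (C * ‖p - p‖)) := by
      rw [← nhds_prod_eq]
      exact Continuous.tendsto (f := fun z : H × H => C * ‖z.1 - z.2‖) (by fun_prop) (p, p)
    rw [sub_self, norm_zero, mul_zero] at h1
    exact h1.mono_left (Filter.prod_mono nhdsWithin_le_nhds nhdsWithin_le_nhds)
  have heq : ∀ᶠ z in f, z.1 = z.2 := by
    filter_upwards [hC, hlim.eventually (gt_mem_nhds one_pos)] with z h1 h2
    rw [norm_pow, norm_norm, pow_two, ← mul_assoc] at h1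
    by_contra hne
    have h3 : 0 < ‖z.1 - z.2‖ := norm_pos_iff.2 (sub_ne_zero.2 hne)
    nlinarith
  have hcur := heq.curry
  obtain ⟨x, hx, hxW⟩ := (hcur.and eventually_mem_nhdsWithin).exists
  have hxp : ∀ᶠ y in 𝓝[W] p, y ≠ x := by
    refine Eventually.filter_mono nhdsWithin_le_nhds ?_
    exact isOpen_ne.mem_nhds (fun h => hpW (h ▸ hxW))
  obtain ⟨y, h1, h2⟩ := (hx.and hxp).exists
  exact h2 h1.symm

lemma countable_setOf_isPowerCenter (hK : Convex ℝ K) {n : ℕ} (hn : 2 ≤ n) {R c : ℝ} :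
    {p | IsPowerCenter K n R c p}.Countable := by
  set W := {p | IsPowerCenter K n R c p} with hW
  have hdisc : DiscreteTopology W := by
    rw [discreteTopology_subtype_iff]
    intro p hp
    have key := nhdsWithin_eq_bot_of_inner_isBigO (W := W \ {p}) (p := p) (fun h => h.2 rfl) ?_
    · rw [nhdsWithin, inf_assoc, inf_principal, Set.inter_comm, ← Set.sdiff_eq]
      exact key
    have hq : ∀ q ∈ W \ {p}, (fun z : H × H => ‖z.1 - q‖ ^ 2 - ‖z.2 - q‖ ^ 2)
        =O[𝓝[W \ {p}] p ×ˢ 𝓝[W \ {p}] p] fun z => ‖z.1 - z.2‖ ^ 2 := by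
      intro q hq
      have hδ : 0 < ‖p - q‖ / 2 := half_pos (norm_pos_iff.2 (sub_ne_zero.2 fun h => hq.2 h.symm))
      have h1 : ∀ᶠ r in 𝓝[W \ {p}] p, r ∈ W ∧ ‖p - q‖ / 2 ≤ ‖r - q‖ := by
        refine (eventually_mem_nhdsWithin.mono fun r hr => hr.1).and ?_
        refine Eventually.filter_mono nhdsWithin_le_nhds ?_
        have h2 : ContinuousAt (fun r => ‖r - q‖) p := by fun_prop
        exact h2.eventually (le_mem_nhds (by linarith))
      refine IsBigO.of_bound (2 * R * (2 * R / (‖p - q‖ / 2) * (R / (‖p - q‖ / 2) ^ 2)))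
        ((h1.prod_mk h1).mono fun z hz => ?_)
      rw [Real.norm_eq_abs, norm_pow, norm_norm]
      exact abs_norm_sub_sq_sub_le hK hn hq.1 hz.1.1 hz.2.1 hδ hz.1.2 hz.2.2
    intro q hqW q' hqW'
    have h1 := ((hq q' hqW').sub (hq q hqW)).const_mul_left (1 / 2)
    refine h1.congr_left fun z => ?_
    simp only [norm_sub_sq_real, inner_sub_left, inner_sub_right, real_inner_comm q,
      real_inner_comm q']
    ring
  exact Set.countable_coe_iff.1 (TopologicalSpace.separableSpace_iff_countable.1 inferInstance)

end Countable

section Main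

variable {E H : Type*} [NormedAddCommGroup E] [InnerProductSpace ℝ E] {B : Set E}
  [NormedAddCommGroup H] [InnerProductSpace ℝ H] {ι : H →ₗᵢ[ℝ] E} {u₀ : E}

lemma isPowerCenter_of_center (hBc : IsCompact B) (hBv : Convex ℝ B)
    (hB0 : 0 ∈ interior B) {n : ℕ} {R c : ℝ} (hR : ∀ u : E, ‖u‖ = 1 → (gauge B u)⁻¹ ≤ R)
    (hc : ∀ u : E, ‖u‖ = 1 → (gauge B u)⁻¹ ^ n + (gauge B (-u))⁻¹ ^ n = c)
    {g : E ≃ₗᵢ[ℝ] E} {p : H} {k : H ≃ₗᵢ[ℝ] H} (h : ∀ y, g (ι y) ∈ B ↔ ι (p + k y) ∈ B) :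
    IsPowerCenter (ι ⁻¹' B) n R c p := by
  have h' : ∀ y, p + y ∈ ι ⁻¹' B ↔ g (ι (k.symm y)) ∈ B := fun y => by
    rw [h, k.apply_symm_apply, Set.mem_preimage]
  refine ⟨?_, fun v hv => ?_⟩
  · rw [mem_interior_iff_mem_nhds] at hB0 ⊢
    have h1 : ContinuousAt (fun x => g (ι (k.symm (x - p)))) p := by fun_prop
    have h2 := h1.preimage_mem_nhds (t := B) (by simpa using hB0)
    filter_upwards [h2] with x hx
    have h3 := (h' (x - p)).2 hx
    rwa [add_sub_cancel] at h3
  · have hw : ‖g (ι (k.symm v))‖ = 1 := by simpa using hv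
    have hw0 : g (ι (k.symm v)) ≠ 0 := norm_pos_iff.1 (by rw [hw]; norm_num)
    refine ⟨(gauge B (g (ι (k.symm v))))⁻¹, (gauge B (-g (ι (k.symm v))))⁻¹,
      inv_pos.2 (gauge_pos_of_ne_zero hBc hB0 hw0), hR _ hw,
      inv_pos.2 (gauge_pos_of_ne_zero hBc hB0 (neg_ne_zero.2 hw0)), fun s => ?_, hc _ hw⟩
    rw [h', ← smul_mem_iff_neg_le_and_le hBc hBv hB0 hw0]
    simp only [map_smul]

lemma eq_closedBall_of_inv_gauge_pow_add_eq (hE : 1 < Module.rank ℝ E) (hBc : IsCompact B)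
    (hBv : Convex ℝ B) (hB0 : 0 ∈ interior B) {n : ℕ} (hn : n ≠ 0) {c c' : ℝ}
    (hc : ∀ u : E, ‖u‖ = 1 → (gauge B u)⁻¹ ^ n + (gauge B (-u))⁻¹ ^ n = c)
    (hc' : ∀ u : E, ‖u‖ = 1 → (gauge B u)⁻¹ ^ (n + n) + (gauge B (-u))⁻¹ ^ (n + n) = c')
    (hu₀ : ‖u₀‖ = 1) : ∃ r : ℝ, 0 < r ∧ B = closedBall 0 r := by
  have hne : ∀ u : E, ‖u‖ = 1 → u ≠ 0 := fun u hu => norm_pos_iff.1 (by rw [hu]; norm_num)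
  have hpos : ∀ u : E, ‖u‖ = 1 → 0 < gauge B u := fun u hu =>
    gauge_pos_of_ne_zero hBc hB0 (hne u hu)
  have hcont := continuous_gauge hBv (mem_interior_iff_mem_nhds.1 hB0)
  set S := (fun u => (gauge B u)⁻¹ ^ n) '' sphere (0 : E) 1 with hS
  have hSpre : IsPreconnected S := by
    refine (isPreconnected_sphere hE 0 1).image _ ?_
    refine (hcont.continuousOn.inv₀ fun u hu => ?_).pow n
    exact (hpos u (by simpa using hu)).ne'
  have hSfin : S.Finite := by
    refine (Set.Finite.insert ((c + Real.sqrt (2 * c' - c ^ 2)) / 2)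
      (Set.finite_singleton ((c - Real.sqrt (2 * c' - c ^ 2)) / 2))).subset ?_
    rintro _ ⟨u, hu, rfl⟩
    have hu1 : ‖u‖ = 1 := by simpa using hu
    have h1 := hc u hu1
    have h2 := hc' u hu1
    simp only [pow_add] at h2
    set x := (gauge B u)⁻¹ ^ n
    have h3 : 2 * c' - c ^ 2 = (2 * x - c) ^ 2 := by
      rw [← h1, ← h2]; ring
    rw [h3, Real.sqrt_sq_eq_abs]
    rcases abs_choice (2 * x - c) with h | h <;> rw [h]
    · exact Or.inl (by ring)
    · exact Or.inr (show x = _ by ring)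
  have hsub : S.Subsingleton := hSfin.countable.isTotallyDisconnected S subset_rfl hSpre
  have hconst : ∀ u : E, ‖u‖ = 1 → gauge B u = gauge B u₀ := by
    intro u hu
    have h1 : (gauge B u)⁻¹ ^ n = (gauge B u₀)⁻¹ ^ n :=
      hsub ⟨u, by simpa using hu, rfl⟩ ⟨u₀, by simpa using hu₀, rfl⟩
    exact inv_injective ((pow_left_inj₀ (inv_nonneg.2 (hpos u hu).le)
      (inv_nonneg.2 (hpos u₀ hu₀).le) hn).1 h1)
  refine ⟨(gauge B u₀)⁻¹, inv_pos.2 (hpos u₀ hu₀), ?_⟩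
  ext x
  rw [mem_closedBall_zero_iff, ← gauge_le_one_iff_mem hBc hBv hB0]
  rcases eq_or_ne x 0 with rfl | hx
  · simpa using (hpos u₀ hu₀).le
  · have hx' := norm_pos_iff.2 hx
    have h1 : gauge B x = ‖x‖ * gauge B u₀ := by
      rw [← hconst (‖x‖⁻¹ • x) (by rw [norm_smul, norm_inv, norm_norm, inv_mul_cancel₀ hx'.ne']),
        gauge_smul_of_nonneg (inv_nonneg.2 hx'.le), smul_eq_mul, mul_inv_cancel_left₀ hx'.ne']
    rw [h1, ← one_div, le_div_iff₀ (hpos u₀ hu₀)]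

variable [FiniteDimensional ℝ H] [MeasurableSpace H] [BorelSpace H] [MeasurableSpace E]
  [BorelSpace E]

/-- A convex body all of whose central sections are congruent is a centred ball. -/
lemma exists_eq_closedBall_of_congruent [FiniteDimensional ℝ E] (hE : 1 < Module.rank ℝ E)
    (hH : 2 ≤ Module.finrank ℝ H)
    (hBc : IsCompact B) (hBv : Convex ℝ B) (hB0 : 0 ∈ interior B)
    (hu₀ : ‖u₀‖ = 1) (hι : ∀ x, (∃ y, ι y = x) ↔ ⟪u₀, x⟫ = 0)
    (hsec : ∀ g : E ≃ₗᵢ[ℝ] E,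
      ∃ f : E ≃ᵢ E, f '' (B ∩ Set.range fun y => g (ι y)) = B ∩ Set.range ι) :
    ∃ r : ℝ, 0 < r ∧ B = closedBall 0 r := by
  have : Nontrivial H := Module.nontrivial_of_finrank_pos (R := ℝ) (by omega)
  choose p k hpk using fun g => exists_center_of_congruent hB0 hι g (hsec g)
  have hc := fun u hu => inv_gauge_pow_add_eq_of_section_integral_eq (u := u) hBc hBv hB0 hu₀ hι 0
    (J := ∫ x, (ι ⁻¹' B).indicator (fun _ => (1 : ℝ)) x)
    (fun g => by simpa only [pow_zero] using integral_section_eq_of_center (hpk g) 0) hu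
  obtain ⟨R, hR⟩ := hBc.isBounded.subset_closedBall 0
  have hR' : ∀ u : E, ‖u‖ = 1 → (gauge B u)⁻¹ ≤ R := by
    intro u hu
    have hu0 : u ≠ 0 := norm_pos_iff.1 (by rw [hu]; norm_num)
    have h0 := inv_pos.2 (gauge_pos_of_ne_zero hBc hB0 hu0)
    have h1 := hR ((smul_mem_iff_le_inv_gauge hBc hBv hB0 hu0 h0.le).2 le_rfl)
    rwa [mem_closedBall_zero_iff, norm_smul, hu, mul_one, Real.norm_of_nonneg h0.le] at h1
  simp only [add_zero] at hc
  have hcenter := fun g => isPowerCenter_of_center hBc hBv hB0 hR' hc (hpk g)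
  have hcount : (Set.range fun g : E ≃ₗᵢ[ℝ] E =>
      ∫ y, B.indicator (fun x => ‖x‖ ^ Module.finrank ℝ H) (g (ι y))).Countable := by
    have hp : (Set.range p).Countable :=
      Set.Countable.mono (Set.range_subset_iff.2 hcenter) (countable_setOf_isPowerCenter
        (K := ι ⁻¹' B) (hBv.linear_preimage ι.toLinearMap) hH)
    refine (hp.image fun q =>
      ∫ x, (ι ⁻¹' B).indicator (fun x => ‖x - q‖ ^ Module.finrank ℝ H) x).mono ?_
    rintro _ ⟨g, rfl⟩
    exact ⟨p g, ⟨g, rfl⟩, (integral_section_eq_of_center (hpk g) _).symm⟩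
  exact eq_closedBall_of_inv_gauge_pow_add_eq hE hBc hBv hB0 (by omega) hc
    (fun u hu => inv_gauge_pow_add_eq_of_section_integral_eq hBc hBv hB0 hu₀ hι
      (Module.finrank ℝ H) (fun g => section_integral_eq_of_countable hE hBc hBv hB0 hu₀ hι
        (Module.finrank ℝ H) hcount g (.refl ℝ E)) hu) hu₀

end Main

end CongruentSections

/-- Schneider's theorem: if all hyperplane sections through the origin of a
convex body `B ⊆ ℝ^{n+1}` are congruent, then `B` is a ball centered at the origin. -/
theorem congruent_central_sections_implies_ball
    (n : ℕ) (hn : 2 ≤ n)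
    (B : Set (EuclideanSpace ℝ (Fin (n + 1))))
    (hBcompact : IsCompact B) (hBconv : Convex ℝ B)
    (hB0 : (0 : EuclideanSpace ℝ (Fin (n + 1))) ∈ interior B)
    (hsec : ∀ H₁ H₂ : Submodule ℝ (EuclideanSpace ℝ (Fin (n + 1))),
      Module.finrank ℝ H₁ = n → Module.finrank ℝ H₂ = n →
        ∃ f : EuclideanSpace ℝ (Fin (n + 1)) ≃ᵢ EuclideanSpace ℝ (Fin (n + 1)),
          f '' (B ∩ (H₁ : Set (EuclideanSpace ℝ (Fin (n + 1))))) =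
            B ∩ (H₂ : Set (EuclideanSpace ℝ (Fin (n + 1))))) :
    ∃ r : ℝ, 0 < r ∧ B = closedBall 0 r := by
  let u₀ : EuclideanSpace ℝ (Fin (n + 1)) := EuclideanSpace.single 0 1
  have hu₀ : ‖u₀‖ = 1 := by simp [u₀]
  have hu₀' : u₀ ≠ 0 := norm_pos_iff.1 (by rw [hu₀]; norm_num)
  have : Fact (Module.finrank ℝ (EuclideanSpace ℝ (Fin (n + 1))) = n + 1) := ⟨by simp⟩
  have hfin : Module.finrank ℝ (ℝ ∙ u₀)ᗮ = n := Submodule.finrank_orthogonal_span_singleton hu₀'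
  have hrank : 1 < Module.rank ℝ (EuclideanSpace ℝ (Fin (n + 1))) := by
    rw [← Module.finrank_eq_rank, finrank_euclideanSpace_fin]
    exact_mod_cast (by omega : 1 < n + 1)
  refine exists_eq_closedBall_of_congruent (ι := (ℝ ∙ u₀)ᗮ.subtypeₗᵢ) hrank (by omega) hBcompact
    hBconv hB0 hu₀ (fun x => ?_) fun g => ?_
  · rw [← Submodule.mem_orthogonal_singleton_iff_inner_right]
    exact ⟨fun ⟨y, hy⟩ => hy ▸ y.2, fun hx => ⟨⟨x, hx⟩, rfl⟩⟩
  · obtain ⟨f, hf⟩ := hsec ((ℝ ∙ u₀)ᗮ.map g.toLinearEquiv.toLinearMap) (ℝ ∙ u₀)ᗮ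
      ((LinearEquiv.finrank_map_eq g.toLinearEquiv _).trans hfin) hfin
    refine ⟨f, ?_⟩
    convert hf using 3
    · ext x; simp
    · ext x; simp
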